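/- arXiv:1305.4332 — 2 statements merged into one kernel-verified Lean document; each statement's English description precedes it below -/
import Mathlib

section
/- Let α > 0, p > 1 with 0 < αp < N, and 0 < R ≤ ∞. There exists a constant c_1 depending only on N, α, p such that for every nonnegative Radon measure μ on ℝ^N and every q ≥ p−1: (c_1 q)^{−q/(p−1)} ∫_{ℝ^N} (I_{αp}^R[μ](x))^{q/(p−1)} dx ≤ ∫_{ℝ^N} (W_{α,p}^R[μ](x))^q dx ≤ (c_1 q)^q ∫_{ℝ^N} (I_{αp}^R[μ](x))^{q/(p−1)} dx. -/
open MeasureTheory ENNReal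

/-- The `R`-truncated Wolff potential (with `R = ∞` allowed). -/
noncomputable def wolffE (N : ℕ) (α p : ℝ) (R : ℝ≥0∞)
    (μ : Measure (EuclideanSpace ℝ (Fin N))) (x : EuclideanSpace ℝ (Fin N)) : ℝ≥0∞ :=
  ∫⁻ t in {t : ℝ | 0 < t ∧ ENNReal.ofReal t < R},
    (μ (Metric.ball x t) / ENNReal.ofReal (t ^ ((N : ℝ) - α * p))) ^ (1 / (p - 1)) *
      ENNReal.ofReal t⁻¹

/-- The `R`-truncated Riesz potential (with `R = ∞` allowed). -/
noncomputable def rieszE (N : ℕ) (α p : ℝ) (R : ℝ≥0∞)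
    (μ : Measure (EuclideanSpace ℝ (Fin N))) (x : EuclideanSpace ℝ (Fin N)) : ℝ≥0∞ :=
  ∫⁻ t in {t : ℝ | 0 < t ∧ ENNReal.ofReal t < R},
    (μ (Metric.ball x t) / ENNReal.ofReal (t ^ ((N : ℝ) - α * p))) *
      ENNReal.ofReal t⁻¹


lemma wr_mvt (r : ℝ) (hr : 1 ≤ r) (x c : ℝ≥0∞) :
    (x + c) ^ r ≤ x ^ r + ENNReal.ofReal r * c * (x + c) ^ (r - 1) := by
  have hr0 : 0 < r := by linarith
  by_cases hx : x = ⊤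
  · subst hx; simp [ENNReal.top_rpow_of_pos hr0]
  by_cases hc : c = ⊤
  · subst hc
    have h1 : ENNReal.ofReal r * ⊤ * (x + ⊤) ^ (r - 1) = ⊤ := by
      rw [ENNReal.mul_top (by simpa using hr0), add_top, ENNReal.top_mul]
      rcases hr.eq_or_lt with h | h
      · simp [← h]
      · rw [ENNReal.top_rpow_of_pos (by linarith)]; simp
    rw [h1]; simp
  by_cases hy0 : x + c = 0
  · rw [hy0, ENNReal.zero_rpow_of_pos hr0]; exact zero_le
  lift x to NNReal using hx
  lift c to NNReal using hc
  have hy0' : (0:ℝ) < (x:ℝ) + c := by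
    have : x + c ≠ 0 := by exact_mod_cast hy0
    exact_mod_cast pos_iff_ne_zero.mpr this
  have e1 : ((x:ℝ≥0∞) + c) = ENNReal.ofReal ((x:ℝ) + c) := by
    rw [ENNReal.ofReal_add x.coe_nonneg c.coe_nonneg]; simp
  have e2 : (x:ℝ≥0∞) = ENNReal.ofReal (x:ℝ) := by simp
  have e3 : (c:ℝ≥0∞) = ENNReal.ofReal (c:ℝ) := by simp
  rw [e1, e2, e3]
  rw [ENNReal.ofReal_rpow_of_pos hy0', ENNReal.ofReal_rpow_of_nonneg x.coe_nonneg hr0.le,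
    ENNReal.ofReal_rpow_of_pos hy0', ← ENNReal.ofReal_mul hr0.le,
    ← ENNReal.ofReal_mul (mul_nonneg hr0.le c.coe_nonneg), ← ENNReal.ofReal_add
      (Real.rpow_nonneg x.coe_nonneg _) (by have := c.coe_nonneg; positivity)]
  apply ENNReal.ofReal_le_ofReal
  set y : ℝ := (x:ℝ) + c with hy
  have hb := one_add_mul_self_le_rpow_one_add (s := -(c:ℝ)/y) (p := r) (by
    rw [le_div_iff₀ hy0']; have := x.coe_nonneg; simp only [hy]; linarith [x.coe_nonneg]) hr
  have e4 : 1 + -(c:ℝ)/y = x / y := by field_simp; simp [hy]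
  rw [e4, Real.div_rpow x.coe_nonneg hy0'.le] at hb
  have hyr : 0 < y ^ r := Real.rpow_pos_of_pos hy0' r
  rw [le_div_iff₀ hyr] at hb
  have e5 : y ^ (r - 1) = y ^ r / y := Real.rpow_sub_one hy0'.ne' r
  rw [e5]
  have e6 : (1 + r * (-(c:ℝ)/y)) * y ^ r = y ^ r - r * c * (y ^ r / y) := by
    field_simp; ring
  linarith

lemma wr_abs {X Z : Type*} [MeasurableSpace X] (ν : Measure X) (c : ℕ → X → ℝ≥0∞)
    (hc : ∀ k, Measurable (c k)) (M : X → ℝ≥0∞) (hM : Measurable M)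
    (hcM : ∀ k x, c k x ≤ M x) (C : ℝ≥0∞) (hC : C ≠ ⊤) (ι : ℕ → X → Z)
    (hι : ∀ j k, j ≤ k → ∀ x y, ι k x = ι k y → c j x = c j y)
    (H : ∀ k n (d : X → ℝ≥0∞), Measurable d → (∀ x y, ι k x = ι k y → d x = d y) →
      ∫⁻ x, d x * ∑ j ∈ Finset.Ico k n, c j x ∂ν ≤ C * ∫⁻ x, d x * c k x ∂ν)
    (r : ℝ) (hr : 1 ≤ r) (n : ℕ) :
    ∫⁻ x, (∑ k ∈ Finset.range n, c k x) ^ r ∂ν ≤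
      (C * ENNReal.ofReal r) ^ r * ∫⁻ x, (M x) ^ r ∂ν := by
  have hr0 : 0 < r := by linarith
  let A : ℕ → X → ℝ≥0∞ := fun k x => ∑ j ∈ Finset.range k, c j x
  have hAm : ∀ k, Measurable (A k) := fun k => Finset.measurable_fun_sum _ fun i _ => hc i
  have hAs : ∀ k x, A (k+1) x = A k x + c k x := fun k x => Finset.sum_range_succ _ _
  have hAmono : ∀ x, Monotone fun k => A k x := fun x =>
    monotone_nat_of_le_succ fun k => by simp only [hAs]; exact le_self_add
  -- increments
  let d : ℕ → X → ℝ≥0∞ := fun k x =>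
    if k = 0 then (A 1 x) ^ (r - 1) else (A (k+1) x) ^ (r - 1) - (A k x) ^ (r - 1)
  have hdm : ∀ k, Measurable (d k) := by
    intro k
    by_cases hk : k = 0
    · simp only [d, hk, if_true]; exact (hAm 1).pow_const _
    · simp only [d, hk, if_false]; exact ((hAm _).pow_const _).sub ((hAm _).pow_const _)
  have hdsum : ∀ k x, ∑ j ∈ Finset.range (k+1), d j x = (A (k+1) x) ^ (r - 1) := by
    intro k x
    induction k with
    | zero => simp [d]
    | succ k ih =>
      rw [Finset.sum_range_succ, ih]
      simp only [d, Nat.succ_ne_zero, if_false]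
      exact add_tsub_cancel_of_le
        (ENNReal.rpow_le_rpow (hAmono x (Nat.le_succ _)) (by linarith))
  have hAι : ∀ k x y, ι k x = ι k y → ∀ j ≤ k + 1, A j x = A j y := by
    intro k x y h j hj
    refine Finset.sum_congr rfl fun i hi => hι i k ?_ x y h
    have := Finset.mem_range.mp hi; omega
  have hdι : ∀ k x y, ι k x = ι k y → d k x = d k y := by
    intro k x y h
    simp only [d]
    rw [hAι k x y h (k+1) le_rfl, hAι k x y h k (by omega), hAι k x y h 1 (by omega)]
  -- pointwise
  have hpt : ∀ n x, (A n x) ^ r ≤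
      ENNReal.ofReal r * ∑ k ∈ Finset.range n, c k x * (A (k+1) x) ^ (r - 1) := by
    intro n x
    induction n with
    | zero => simp [A, hr0]
    | succ n ih =>
      rw [Finset.sum_range_succ, mul_add, hAs]
      refine (wr_mvt r hr _ _).trans ?_
      rw [← hAs, mul_assoc]
      exact add_le_add ih le_rfl
  have hsw : ∀ x, ∑ k ∈ Finset.range n, c k x * (A (k+1) x) ^ (r - 1) =
      ∑ k ∈ Finset.range n, d k x * ∑ j ∈ Finset.Ico k n, c j x := by
    intro x
    simp_rw [← hdsum, Finset.mul_sum]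
    simp_rw [Finset.range_eq_Ico]
    rw [Finset.sum_Ico_Ico_comm]
    refine Finset.sum_congr rfl fun i hi => ?_
    refine Finset.sum_congr rfl fun j hj => mul_comm _ _
  have key : ∫⁻ x, (A n x) ^ r ∂ν ≤
      (C * ENNReal.ofReal r) * ∫⁻ x, M x * (A n x) ^ (r - 1) ∂ν := by
    calc ∫⁻ x, (A n x) ^ r ∂ν
        ≤ ∫⁻ x, ENNReal.ofReal r *
            ∑ k ∈ Finset.range n, d k x * ∑ j ∈ Finset.Ico k n, c j x ∂ν := by
          refine lintegral_mono fun x => ?_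
          rw [← hsw]; exact hpt n x
      _ = ENNReal.ofReal r * ∑ k ∈ Finset.range n,
            ∫⁻ x, d k x * ∑ j ∈ Finset.Ico k n, c j x ∂ν := by
          rw [lintegral_const_mul' _ _ ENNReal.ofReal_ne_top, lintegral_finsetSum]
          intro k _
          exact (hdm k).mul (Finset.measurable_fun_sum _ fun i _ => hc i)
      _ ≤ ENNReal.ofReal r * ∑ k ∈ Finset.range n, C * ∫⁻ x, d k x * c k x ∂ν := by
          gcongr with k _
          exact H k n (d k) (hdm k) (hdι k)
      _ = ENNReal.ofReal r * (C * ∫⁻ x, ∑ k ∈ Finset.range n, d k x * c k x ∂ν) := by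
          rw [← Finset.mul_sum, lintegral_finsetSum]
          intro k _; exact (hdm k).mul (hc k)
      _ ≤ ENNReal.ofReal r * (C * ∫⁻ x, M x * (A n x) ^ (r - 1) ∂ν) := by
          gcongr with x
          rcases Nat.eq_zero_or_pos n with h0 | h0
          · subst h0; simp
          obtain ⟨m, rfl⟩ : ∃ m, n = m + 1 := ⟨n - 1, by omega⟩
          rw [← hdsum, Finset.mul_sum]
          refine Finset.sum_le_sum fun k _ => ?_
          rw [mul_comm]; gcongr; exact hcM k x
      _ = _ := by ring
  by_cases hMtop : ∫⁻ x, (M x) ^ r ∂ν = ⊤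
  · rcases eq_or_ne C 0 with hC0 | hC0
    · subst hC0
      simp only [zero_mul] at key
      exact key.trans zero_le
    · rw [hMtop, ENNReal.mul_top]; · exact le_top
      have : C * ENNReal.ofReal r ≠ 0 := mul_ne_zero hC0 (by simpa using hr0)
      rw [Ne, ENNReal.rpow_eq_zero_iff]
      push Not
      exact ⟨fun h => absurd h this, fun h => absurd h (ENNReal.mul_ne_top hC (by simp))⟩
  have hAfin : ∫⁻ x, (A n x) ^ r ∂ν ≠ ⊤ := by
    have : ∫⁻ x, (A n x) ^ r ∂ν ≤ ((n:ℝ≥0∞)) ^ r * ∫⁻ x, (M x) ^ r ∂ν := by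
      rw [← lintegral_const_mul' _ _ (ENNReal.rpow_ne_top_of_nonneg hr0.le (by simp))]
      refine lintegral_mono fun x => ?_
      simp only
      rw [← ENNReal.mul_rpow_of_nonneg _ _ hr0.le]
      refine ENNReal.rpow_le_rpow ?_ hr0.le
      calc A n x ≤ ∑ k ∈ Finset.range n, M x := Finset.sum_le_sum fun k _ => hcM k x
        _ = n * M x := by simp
    exact ne_top_of_le_ne_top
      (ENNReal.mul_ne_top (ENNReal.rpow_ne_top_of_nonneg hr0.le (by simp)) hMtop) this
  have hold : ∫⁻ x, M x * (A n x) ^ (r - 1) ∂ν ≤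
      (∫⁻ x, (M x) ^ r ∂ν) ^ (1 / r) * (∫⁻ x, (A n x) ^ r ∂ν) ^ (1 - 1 / r) := by
    have := ENNReal.lintegral_mul_norm_pow_le (μ := ν) (f := fun x => (M x) ^ r)
      (g := fun x => (A n x) ^ r) (hM.pow_const r).aemeasurable
      ((hAm n).pow_const r).aemeasurable (p := 1 / r) (q := 1 - 1 / r) (by positivity)
      (by rw [sub_nonneg, div_le_one hr0]; exact hr) (by ring)
    refine le_trans (le_of_eq ?_) this
    refine lintegral_congr fun x => ?_
    rw [← ENNReal.rpow_mul, ← ENNReal.rpow_mul, mul_one_div_cancel hr0.ne', ENNReal.rpow_one]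
    congr 2; field_simp
  set Xx := ∫⁻ x, (A n x) ^ r ∂ν
  set Y := ∫⁻ x, (M x) ^ r ∂ν
  change Xx ≤ _
  by_cases hX0 : Xx = 0
  · rw [hX0]; exact zero_le
  have h1 : Xx ≤ (C * ENNReal.ofReal r) * (Y ^ (1/r) * Xx ^ (1 - 1/r)) := key.trans (by gcongr)
  have h2 : Xx ^ (1/r) * Xx ^ (1 - 1/r) = Xx := by
    rw [← ENNReal.rpow_add _ _ hX0 hAfin]; simp
  have h3 : Xx ^ (1/r) * Xx ^ (1 - 1/r) ≤ ((C * ENNReal.ofReal r) * Y ^ (1/r)) * Xx ^ (1 - 1/r) := by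
    rw [h2, mul_assoc]; exact h1
  have h4 : Xx ^ (1/r) ≤ (C * ENNReal.ofReal r) * Y ^ (1/r) := by
    refine (ENNReal.mul_le_mul_iff_left ?_ ?_).mp h3
    · rw [Ne, ENNReal.rpow_eq_zero_iff]; push Not
      exact ⟨fun h => absurd h hX0, fun h => absurd h hAfin⟩
    · exact ENNReal.rpow_ne_top_of_ne_zero hX0 hAfin
  have h5 := ENNReal.rpow_le_rpow h4 hr0.le
  rwa [ENNReal.mul_rpow_of_nonneg _ _ hr0.le, ← ENNReal.rpow_mul, ← ENNReal.rpow_mul,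
    one_div_mul_cancel hr0.ne', ENNReal.rpow_one, ENNReal.rpow_one] at h5

/-- index of the cube of side `h` containing `x` -/
noncomputable def wrIdx {N : ℕ} (h : ℝ) (x : EuclideanSpace ℝ (Fin N)) : Fin N → ℤ :=
  fun i => ⌊x i / h⌋

/-- union of the neighbouring cubes -/
def wrNb {N : ℕ} (h : ℝ) (x : EuclideanSpace ℝ (Fin N)) : Set (EuclideanSpace ℝ (Fin N)) :=
  {y | ∀ i, |wrIdx h y i - wrIdx h x i| ≤ 1}

noncomputable def wrG {N : ℕ} (γ : ℝ) (μ : Measure (EuclideanSpace ℝ (Fin N))) (h : ℝ)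
    (x : EuclideanSpace ℝ (Fin N)) : ℝ≥0∞ :=
  μ (wrNb h x) * ENNReal.ofReal (h ^ (-γ))

section
variable {N : ℕ}

lemma wrIdx_meas (h : ℝ) : Measurable (wrIdx (N := N) h) := by
  refine measurable_pi_lambda _ fun i => ?_
  unfold wrIdx
  exact Int.measurable_floor.comp (by fun_prop)

lemma wrNb_meas (h : ℝ) (x : EuclideanSpace ℝ (Fin N)) : MeasurableSet (wrNb h x) := by
  have : wrNb h x = wrIdx h ⁻¹' {z | ∀ i, |z i - wrIdx h x i| ≤ 1} := rfl
  rw [this]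
  exact wrIdx_meas h (Set.to_countable _).measurableSet

lemma wrNb_prod_meas (h : ℝ) :
    MeasurableSet {z : EuclideanSpace ℝ (Fin N) × EuclideanSpace ℝ (Fin N) | z.2 ∈ wrNb h z.1} := by
  have : {z : EuclideanSpace ℝ (Fin N) × EuclideanSpace ℝ (Fin N) | z.2 ∈ wrNb h z.1} =
    (fun z : EuclideanSpace ℝ (Fin N) × EuclideanSpace ℝ (Fin N) => (wrIdx h z.1, wrIdx h z.2)) ⁻¹'
      {w | ∀ i, |w.2 i - w.1 i| ≤ 1} := rfl
  rw [this]
  exact (((wrIdx_meas h).comp measurable_fst).prodMk ((wrIdx_meas h).comp measurable_snd))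
    (Set.to_countable _).measurableSet

lemma wrNb_congr {h : ℝ} {x y : EuclideanSpace ℝ (Fin N)} (e : wrIdx h x = wrIdx h y) :
    wrNb h x = wrNb h y := by
  unfold wrNb; rw [e]

lemma wrNb_symm {h : ℝ} {x y : EuclideanSpace ℝ (Fin N)} (e : y ∈ wrNb h x) : x ∈ wrNb h y :=
  fun i => by rw [abs_sub_comm]; exact e i

lemma wrG_congr {γ : ℝ} {μ : Measure (EuclideanSpace ℝ (Fin N))} {h : ℝ}
    {x y : EuclideanSpace ℝ (Fin N)} (e : wrIdx h x = wrIdx h y) :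
    wrG γ μ h x = wrG γ μ h y := by
  unfold wrG; rw [wrNb_congr e]

lemma wrG_meas (γ : ℝ) (μ : Measure (EuclideanSpace ℝ (Fin N))) (h : ℝ) :
    Measurable (wrG γ μ h) := by
  have : wrG γ μ h = (fun z : Fin N → ℤ =>
      μ (wrIdx h ⁻¹' {w | ∀ i, |w i - z i| ≤ 1}) * ENNReal.ofReal (h ^ (-γ))) ∘ wrIdx h := rfl
  rw [this]
  exact (measurable_of_countable _).comp (wrIdx_meas h)

lemma wr_ball_sub {h t : ℝ} (hh : 0 < h) (ht : t ≤ h) (x : EuclideanSpace ℝ (Fin N)) :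
    Metric.ball x t ⊆ wrNb h x := by
  intro y hy i
  have h1 : |y i - x i| < h := by
    have := PiLp.norm_apply_le (y - x) i
    rw [Metric.mem_ball, dist_eq_norm] at hy
    simp only [PiLp.sub_apply, Real.norm_eq_abs] at this
    linarith
  have h2 : |y i / h - x i / h| < 1 := by
    rw [← sub_div, abs_div, abs_of_pos hh, div_lt_one hh]; exact h1
  rw [abs_lt] at h2
  unfold wrIdx
  rw [abs_le]
  have a1 := Int.floor_le (y i / h)
  have a2 := Int.lt_floor_add_one (y i / h)
  have a3 := Int.floor_le (x i / h)
  have a4 := Int.lt_floor_add_one (x i / h)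
  have b1 : ⌊y i / h⌋ < ⌊x i / h⌋ + 2 := by
    have : (⌊y i / h⌋ : ℝ) < ⌊x i / h⌋ + 2 := by linarith
    exact_mod_cast this
  have b2 : ⌊x i / h⌋ < ⌊y i / h⌋ + 2 := by
    have : (⌊x i / h⌋ : ℝ) < ⌊y i / h⌋ + 2 := by linarith
    exact_mod_cast this
  constructor <;> omega

lemma wr_dist_le (x y : EuclideanSpace ℝ (Fin N)) (b : ℝ) (hb : 0 ≤ b)
    (h : ∀ i, |y i - x i| ≤ b) : dist y x ≤ N * b := by
  rw [EuclideanSpace.dist_eq]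
  apply Real.sqrt_le_iff.mpr
  refine ⟨by positivity, ?_⟩
  calc ∑ i, dist (y i) (x i) ^ 2 ≤ ∑ i : Fin N, b ^ 2 := by
        gcongr with i; rw [Real.dist_eq]; exact h i
    _ = N * b ^ 2 := by simp
    _ ≤ (N * b) ^ 2 := by
        rw [mul_pow]
        gcongr
        have : N ≤ N ^ 2 := Nat.le_self_pow (by norm_num) N
        exact_mod_cast this

lemma wr_sub_ball {h : ℝ} (hh : 0 < h) (x : EuclideanSpace ℝ (Fin N)) :
    wrNb h x ⊆ Metric.ball x ((2 * N + 1) * h) := by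
  intro y hy
  rw [Metric.mem_ball]
  have : dist y x ≤ N * (2 * h) := by
    refine wr_dist_le x y _ (by positivity) fun i => ?_
    have := hy i
    unfold wrIdx at this
    rw [abs_le] at this
    have c1 : ((-1 : ℤ) : ℝ) ≤ ((⌊y i / h⌋ - ⌊x i / h⌋ : ℤ) : ℝ) := by exact_mod_cast this.1
    have c2 : ((⌊y i / h⌋ - ⌊x i / h⌋ : ℤ) : ℝ) ≤ ((1 : ℤ) : ℝ) := by exact_mod_cast this.2
    push_cast at c1 c2
    have a1 := Int.floor_le (y i / h)
    have a2 := Int.lt_floor_add_one (y i / h)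
    have a3 := Int.floor_le (x i / h)
    have a4 := Int.lt_floor_add_one (x i / h)
    have h2 : |y i / h - x i / h| ≤ 2 := by rw [abs_le]; constructor <;> linarith
    rwa [← sub_div, abs_div, abs_of_pos hh, div_le_iff₀ hh] at h2
  nlinarith

lemma wr_cube_ball {h : ℝ} (hh : 0 < h) (x : EuclideanSpace ℝ (Fin N)) :
    ∃ z, Metric.ball z (h / 2) ⊆ {y | wrIdx h y = wrIdx h x} := by
  refine ⟨WithLp.toLp 2 fun i => (⌊x i / h⌋ + 1/2) * h, ?_⟩
  intro y hy
  funext i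
  have h1 : |y i - (⌊x i / h⌋ + 1/2) * h| < h / 2 := by
    rw [Metric.mem_ball, dist_eq_norm] at hy
    have := PiLp.norm_apply_le (y - WithLp.toLp 2 fun i => ((⌊x i / h⌋ : ℝ) + 1/2) * h) i
    simp only [PiLp.sub_apply, Real.norm_eq_abs] at this
    linarith
  rw [abs_lt] at h1
  unfold wrIdx
  rw [Int.floor_eq_iff, le_div_iff₀ hh, div_lt_iff₀ hh]
  constructor <;> nlinarith

lemma wrIdx_coarse (H : ℝ) {j k : ℕ} (hjk : j ≤ k) (x : EuclideanSpace ℝ (Fin N)) (i : Fin N) :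
    wrIdx (H / 2 ^ j) x i = wrIdx (H / 2 ^ k) x i / ((2 ^ (k - j) : ℕ) : ℤ) := by
  unfold wrIdx
  rw [← Int.floor_div_natCast]
  congr 1
  obtain ⟨m, rfl⟩ := Nat.exists_eq_add_of_le hjk
  rw [Nat.add_sub_cancel_left]
  push_cast
  rw [pow_add]
  field_simp

lemma wrIdx_coarse_congr (H : ℝ) {j k : ℕ} (hjk : j ≤ k) {x y : EuclideanSpace ℝ (Fin N)}
    (e : wrIdx (H / 2 ^ k) x = wrIdx (H / 2 ^ k) y) :
    wrIdx (H / 2 ^ j) x = wrIdx (H / 2 ^ j) y := by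
  funext i
  rw [wrIdx_coarse H hjk, wrIdx_coarse H hjk, e]

lemma wrNb_mono (H : ℝ) {j k : ℕ} (hjk : j ≤ k) (x : EuclideanSpace ℝ (Fin N)) :
    wrNb (H / 2 ^ k) x ⊆ wrNb (H / 2 ^ j) x := by
  intro y hy i
  have := hy i
  rw [wrIdx_coarse H hjk, wrIdx_coarse H hjk]
  set a := wrIdx (H / 2 ^ k) y i
  set b := wrIdx (H / 2 ^ k) x i
  set m : ℤ := ((2 ^ (k - j) : ℕ) : ℤ)
  have hm : 1 ≤ m := by
    have : 1 ≤ 2 ^ (k-j) := Nat.one_le_two_pow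
    exact Int.ofNat_le.mpr this
  have key : ∀ a b : ℤ, a ≤ b + 1 → a / m ≤ b / m + 1 := by
    intro a b hab
    calc a / m ≤ (b + m * 1) / m := Int.ediv_le_ediv (by omega) (by omega)
      _ = b / m + 1 := by rw [Int.add_mul_ediv_left _ _ (by omega)]
  rw [abs_le] at this ⊢
  have k1 := key a b (by omega)
  have k2 := key b a (by omega)
  constructor <;> omega

lemma wr_vol_le [Nonempty (Fin N)] {h : ℝ} (hh : 0 < h) (y : EuclideanSpace ℝ (Fin N)) :
    volume (wrNb h y) ≤ ENNReal.ofReal (((2 * N + 1) * h) ^ N) *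
      volume (Metric.ball (0 : EuclideanSpace ℝ (Fin N)) 1) := by
  refine (measure_mono (wr_sub_ball hh y)).trans ?_
  rw [Measure.addHaar_ball _ _ (by positivity)]
  simp

lemma wr_vol_ge [Nonempty (Fin N)] {h : ℝ} (hh : 0 < h) (x : EuclideanSpace ℝ (Fin N)) :
    ENNReal.ofReal ((h / 2) ^ N) * volume (Metric.ball (0 : EuclideanSpace ℝ (Fin N)) 1) ≤
     volume {y | wrIdx h y = wrIdx h x} := by
  obtain ⟨z, hz⟩ := wr_cube_ball hh x
  refine le_trans (le_of_eq ?_) (measure_mono hz)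
  rw [Measure.addHaar_ball volume z (by positivity)]
  simp

lemma wr_fub0 {X : Type*} [MeasurableSpace X] (ν μ' : Measure X) [SFinite ν] [SFinite μ']
    (T : X → Set X) (hT : ∀ x y, y ∈ T x → x ∈ T y)
    (hS : MeasurableSet {z : X × X | z.2 ∈ T z.1}) :
    ∫⁻ x, μ' (T x) ∂ν = ∫⁻ y, ν (T y) ∂μ' := by
  have e1 := Measure.prod_apply (μ := ν) (ν := μ') hS
  have e2 := Measure.prod_apply_symm (μ := ν) (ν := μ') hS
  have s1 : ∀ x, Prod.mk x ⁻¹' {z : X × X | z.2 ∈ T z.1} = T x := fun x => rfl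
  have s2 : ∀ y, (fun x => (x, y)) ⁻¹' {z : X × X | z.2 ∈ T z.1} = T y := fun y =>
    Set.Subset.antisymm (fun x hx => hT _ _ hx) (fun x hx => hT _ _ hx)
  simp_rw [s1] at e1
  simp_rw [s2] at e2
  exact e1.symm.trans e2

lemma wr_fub (h : ℝ) (μ' : Measure (EuclideanSpace ℝ (Fin N))) [IsFiniteMeasure μ'] :
    ∫⁻ x, μ' (wrNb h x) = ∫⁻ y, volume (wrNb h y) ∂μ' :=
  wr_fub0 volume μ' (wrNb h) (fun _ _ hy => wrNb_symm hy) (wrNb_prod_meas h)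

/-- averaged decay -/
lemma wr_avg [Nonempty (Fin N)] (γ : ℝ) (μ : Measure (EuclideanSpace ℝ (Fin N)))
    {H : ℝ} (hH : 0 < H) {k j : ℕ} (hkj : k ≤ j) (x₀ : EuclideanSpace ℝ (Fin N)) :
    ∫⁻ x in {y | wrIdx (H / 2 ^ k) y = wrIdx (H / 2 ^ k) x₀}, wrG γ μ (H / 2 ^ j) x ≤
      volume {y | wrIdx (H / 2 ^ k) y = wrIdx (H / 2 ^ k) x₀} *
        (ENNReal.ofReal ((2 * (2 * N + 1)) ^ N * (2 ^ (-(N - γ))) ^ (j - k)) *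
          wrG γ μ (H / 2 ^ k) x₀) := by
  set Q := {y | wrIdx (H / 2 ^ k) y = wrIdx (H / 2 ^ k) x₀} with hQ
  set hk := H / 2 ^ k with hhk
  set hj := H / 2 ^ j with hhj
  have hk0 : 0 < hk := by positivity
  have hj0 : 0 < hj := by positivity
  have hQm : MeasurableSet Q := wrIdx_meas hk (measurableSet_singleton _)
  set v := volume (Metric.ball (0 : EuclideanSpace ℝ (Fin N)) 1)
  have hVpos : volume Q ≠ 0 := by
    have := wr_vol_ge hk0 x₀
    intro h0
    rw [h0] at this
    have hv : v ≠ 0 := (Metric.measure_ball_pos volume _ one_pos).ne'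
    have : ENNReal.ofReal ((hk / 2) ^ N) * v = 0 := le_antisymm this zero_le
    rcases mul_eq_zero.mp this with h | h
    · have : 0 < (hk/2)^N := by positivity
      rw [ENNReal.ofReal_eq_zero] at h; linarith
    · exact hv h
  by_cases hfin : μ (wrNb hk x₀) = ⊤
  · have : wrG γ μ hk x₀ = ⊤ := by
      unfold wrG; rw [hfin, ENNReal.top_mul]
      simp only [ne_eq, ENNReal.ofReal_eq_zero, not_le]; positivity
    rw [this, ENNReal.mul_top, ENNReal.mul_top hVpos]; · exact le_top
    simp only [ne_eq, ENNReal.ofReal_eq_zero, not_le]; positivity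
  -- Fubini
  set μ' := μ.restrict (wrNb hk x₀) with hμ'
  have : IsFiniteMeasure μ' := ⟨by rw [hμ', Measure.restrict_apply_univ]; exact lt_top_iff_ne_top.mpr hfin⟩
  have hle : ∫⁻ x in Q, μ (wrNb hj x) ≤
      μ (wrNb hk x₀) * (ENNReal.ofReal (((2 * N + 1) * hj) ^ N) * v) := by
    calc ∫⁻ x in Q, μ (wrNb hj x) = ∫⁻ x in Q, μ' (wrNb hj x) := by
          refine setLIntegral_congr_fun hQm fun x hx => ?_
          rw [hμ', Measure.restrict_apply (wrNb_meas _ _), Set.inter_eq_left.mpr]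
          rw [← wrNb_congr (show wrIdx hk x = wrIdx hk x₀ from hx)]
          exact wrNb_mono H hkj x
      _ ≤ ∫⁻ x, μ' (wrNb hj x) := setLIntegral_le_lintegral _ _
      _ = ∫⁻ y, volume (wrNb hj y) ∂μ' := wr_fub hj μ'
      _ ≤ ∫⁻ y, ENNReal.ofReal (((2 * N + 1) * hj) ^ N) * v ∂μ' :=
          lintegral_mono fun y => wr_vol_le hj0 y
      _ = _ := by
          rw [lintegral_const, hμ', Measure.restrict_apply_univ, mul_comm]
  unfold wrG
  rw [lintegral_mul_const' _ _ ENNReal.ofReal_ne_top]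
  calc (∫⁻ x in Q, μ (wrNb hj x)) * ENNReal.ofReal (hj ^ (-γ))
      ≤ μ (wrNb hk x₀) * (ENNReal.ofReal (((2 * N + 1) * hj) ^ N) * v) * ENNReal.ofReal (hj ^ (-γ)) := by
        gcongr
    _ = (ENNReal.ofReal ((hk / 2) ^ N) * v) * (ENNReal.ofReal ((2 * (2 * N + 1)) ^ N * (2 ^ (-(N - γ))) ^ (j - k)) *
          (μ (wrNb hk x₀) * ENNReal.ofReal (hk ^ (-γ)))) := by
        have real : ((2 * N + 1) * hj) ^ N * hj ^ (-γ) =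
          (hk / 2) ^ N * ((2 * (2 * N + 1)) ^ N * (2 ^ (-(N - γ))) ^ (j - k)) * hk ^ (-γ) := by
          obtain ⟨m, rfl⟩ := Nat.exists_eq_add_of_le hkj
          rw [Nat.add_sub_cancel_left]
          have e : hj = hk / 2 ^ m := by rw [hhj, hhk, pow_add]; field_simp
          rw [e, Real.div_rpow hk0.le (by positivity)]
          have e2 : ((2:ℝ) ^ (-((N:ℝ) - γ))) ^ m = ((2:ℝ) ^ m) ^ (-((N:ℝ)-γ)) := by
            rw [← Real.rpow_natCast, ← Real.rpow_mul (by norm_num), mul_comm, Real.rpow_mul (by norm_num), Real.rpow_natCast]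
          have e3 : ((2:ℝ) ^ m) ^ (-((N:ℝ)-γ)) = (((2:ℝ)^m)^N)⁻¹ * (((2:ℝ)^m) ^ (-γ))⁻¹ := by
            rw [show -((N:ℝ)-γ) = -(N:ℝ) + -(-γ) by ring, Real.rpow_add (by positivity), Real.rpow_neg (by positivity),
              Real.rpow_neg (by positivity) (-γ), Real.rpow_natCast]
          rw [e2, e3]
          have : ((2:ℝ)^m) ^ (-γ) ≠ 0 := by positivity
          simp only [mul_pow, div_pow]
          field_simp
        have r1 := congrArg ENNReal.ofReal real
        rw [ENNReal.ofReal_mul (by positivity), ENNReal.ofReal_mul (by positivity), ENNReal.ofReal_mul (p := (hk/2)^N) (by positivity)] at r1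
        calc _ = (ENNReal.ofReal (((2 * N + 1) * hj) ^ N) * ENNReal.ofReal (hj ^ (-γ))) * (μ (wrNb hk x₀) * v) := by ring
          _ = _ := by rw [r1]; ring
    _ ≤ _ := by gcongr; exact wr_vol_ge hk0 x₀

end

section
variable {N : ℕ}

noncomputable def wrC (N : ℕ) (γ a : ℝ) : ℝ≥0∞ :=
  ∑' m : ℕ, (ENNReal.ofReal ((2 * (2 * N + 1)) ^ N * (2 ^ (-((N:ℝ) - γ))) ^ m)) ^ a

lemma wrC_ne_top (γ a : ℝ) (hγ : γ < N) (ha : 0 < a) : wrC N γ a ≠ ⊤ := by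
  have e : ∀ m : ℕ, (ENNReal.ofReal ((2 * (2 * (N:ℝ) + 1)) ^ N * (2 ^ (-((N:ℝ) - γ))) ^ m)) ^ a =
      (ENNReal.ofReal ((2 * (2 * N + 1)) ^ N)) ^ a *
        ((ENNReal.ofReal (2 ^ (-((N:ℝ) - γ)))) ^ a) ^ m := by
    intro m
    rw [ENNReal.ofReal_mul (by positivity), ENNReal.mul_rpow_of_nonneg _ _ ha.le,
      ENNReal.ofReal_pow (p := 2 ^ (-((N:ℝ) - γ))) (by positivity), ← ENNReal.rpow_natCast,
      ← ENNReal.rpow_natCast, ← ENNReal.rpow_mul, ← ENNReal.rpow_mul, mul_comm a]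
  unfold wrC
  simp_rw [e]
  rw [ENNReal.tsum_mul_left, ENNReal.tsum_geometric]
  refine ENNReal.mul_ne_top (ENNReal.rpow_ne_top_of_nonneg ha.le ENNReal.ofReal_ne_top) ?_
  rw [ENNReal.inv_ne_top]
  apply (tsub_pos_of_lt ?_).ne'
  apply ENNReal.rpow_lt_one _ ha
  rw [ENNReal.ofReal_lt_one]
  exact Real.rpow_lt_one_of_one_lt_of_neg (by norm_num) (by linarith)

lemma wr_H [Nonempty (Fin N)] (γ a : ℝ) (ha : 0 < a) (ha1 : a ≤ 1)
    (μ : Measure (EuclideanSpace ℝ (Fin N)))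
    {H : ℝ} (hH : 0 < H) (k n : ℕ) (d : EuclideanSpace ℝ (Fin N) → ℝ≥0∞)
    (hd : ∀ x y, wrIdx (H / 2 ^ k) x = wrIdx (H / 2 ^ k) y → d x = d y) :
    ∫⁻ x, d x * ∑ j ∈ Finset.Ico k n, (wrG γ μ (H / 2 ^ j) x) ^ a ≤
      wrC N γ a * ∫⁻ x, d x * (wrG γ μ (H / 2 ^ k) x) ^ a := by
  have hm : ∀ z, MeasurableSet (wrIdx (N := N) (H / 2 ^ k) ⁻¹' {z}) := fun z =>
    wrIdx_meas _ (measurableSet_singleton _)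
  have hdisj : Pairwise (Function.onFun Disjoint
      fun z => wrIdx (N := N) (H / 2 ^ k) ⁻¹' {z}) := by
    intro z w hzw
    exact Disjoint.preimage _ (by simpa using hzw)
  have hU : (⋃ z, wrIdx (N := N) (H / 2 ^ k) ⁻¹' {z}) = Set.univ := by
    ext x; simp
  have split : ∀ f : EuclideanSpace ℝ (Fin N) → ℝ≥0∞,
      ∫⁻ x, f x = ∑' z, ∫⁻ x in wrIdx (N := N) (H / 2 ^ k) ⁻¹' {z}, f x := by
    intro f
    rw [← lintegral_iUnion hm hdisj, hU, Measure.restrict_univ]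
  rw [split, split, ← ENNReal.tsum_mul_left]
  refine ENNReal.tsum_le_tsum fun z => ?_
  rcases Set.eq_empty_or_nonempty (wrIdx (N := N) (H / 2 ^ k) ⁻¹' {z}) with h0 | ⟨x₀, hx₀⟩
  · rw [h0]; simp
  have hQ : wrIdx (N := N) (H / 2 ^ k) ⁻¹' {z} =
      {y | wrIdx (H / 2 ^ k) y = wrIdx (H / 2 ^ k) x₀} := by
    rw [← (show wrIdx (H / 2 ^ k) x₀ = z from hx₀)]; rfl
  have hQm := hm z
  rw [hQ] at hQm ⊢
  set Q := {y | wrIdx (H / 2 ^ k) y = wrIdx (H / 2 ^ k) x₀} with hQd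
  set V := volume Q with hV
  have hcm : ∀ j, Measurable fun x => (wrG γ μ (H / 2 ^ j) x) ^ a := fun j =>
    (wrG_meas γ μ _).pow_const a
  have L1 : ∫⁻ x in Q, d x * ∑ j ∈ Finset.Ico k n, (wrG γ μ (H / 2 ^ j) x) ^ a =
      d x₀ * ∑ j ∈ Finset.Ico k n, ∫⁻ x in Q, (wrG γ μ (H / 2 ^ j) x) ^ a := by
    rw [← lintegral_finsetSum _ (fun j _ => hcm j),
      ← lintegral_const_mul _ (Finset.measurable_fun_sum _ fun i _ => hcm i)]
    refine setLIntegral_congr_fun hQm fun x hx => ?_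
    rw [hd x x₀ hx]
  have L2 : ∫⁻ x in Q, d x * (wrG γ μ (H / 2 ^ k) x) ^ a =
      d x₀ * (V * (wrG γ μ (H / 2 ^ k) x₀) ^ a) := by
    have : ∫⁻ x in Q, d x * (wrG γ μ (H / 2 ^ k) x) ^ a =
        ∫⁻ x in Q, d x₀ * (wrG γ μ (H / 2 ^ k) x₀) ^ a := by
      refine setLIntegral_congr_fun hQm fun x hx => ?_
      rw [hd x x₀ hx, wrG_congr (show wrIdx (H / 2 ^ k) x = wrIdx (H / 2 ^ k) x₀ from hx)]
    rw [this, setLIntegral_const, hV]; ring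
  have L3 : ∀ j ∈ Finset.Ico k n, ∫⁻ x in Q, (wrG γ μ (H / 2 ^ j) x) ^ a ≤
      V * (wrG γ μ (H / 2 ^ k) x₀) ^ a *
      (ENNReal.ofReal ((2 * (2 * N + 1)) ^ N * (2 ^ (-((N:ℝ) - γ))) ^ (j - k))) ^ a := by
    intro j hj
    have hkj := (Finset.mem_Ico.mp hj).1
    have h1 := ENNReal.lintegral_mul_norm_pow_le (μ := volume.restrict Q)
      (f := fun x => wrG γ μ (H / 2 ^ j) x) (g := fun _ => 1)
      (wrG_meas γ μ _).aemeasurable aemeasurable_const ha.le (sub_nonneg.mpr ha1) (by ring)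
    simp only [ENNReal.one_rpow, mul_one, lintegral_one, Measure.restrict_apply_univ] at h1
    refine h1.trans ?_
    refine (mul_le_mul_left (ENNReal.rpow_le_rpow (wr_avg γ μ hH hkj x₀) ha.le) _).trans ?_
    rw [← hQd, ← hV, ENNReal.mul_rpow_of_nonneg _ _ ha.le, ENNReal.mul_rpow_of_nonneg _ _ ha.le]
    have : V ^ a * V ^ (1 - a) = V := by
      rw [← ENNReal.rpow_add_of_nonneg _ _ ha.le (sub_nonneg.mpr ha1)]; simp
    apply le_of_eq
    calc _ = (V ^ a * V ^ (1 - a)) * (wrG γ μ (H / 2 ^ k) x₀) ^ a *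
      (ENNReal.ofReal ((2 * (2 * N + 1)) ^ N * (2 ^ (-((N:ℝ) - γ))) ^ (j - k))) ^ a := by ring
      _ = _ := by rw [this]
  rw [L1, L2]
  calc d x₀ * ∑ j ∈ Finset.Ico k n, ∫⁻ x in Q, (wrG γ μ (H / 2 ^ j) x) ^ a
      ≤ d x₀ * ∑ j ∈ Finset.Ico k n, V * (wrG γ μ (H / 2 ^ k) x₀) ^ a *
      (ENNReal.ofReal ((2 * (2 * N + 1)) ^ N * (2 ^ (-((N:ℝ) - γ))) ^ (j - k))) ^ a := by
        gcongr with j hj; exact L3 j hj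
    _ ≤ d x₀ * (V * (wrG γ μ (H / 2 ^ k) x₀) ^ a * wrC N γ a) := by
        rw [← Finset.mul_sum]
        gcongr
        rw [Finset.sum_Ico_eq_sum_range]
        simp only [Nat.add_sub_cancel_left]
        exact ENNReal.sum_le_tsum _
    _ = _ := by ring

lemma wr_disc1 [Nonempty (Fin N)] (γ a : ℝ) (hγ : γ < N) (ha : 0 < a) (ha1 : a ≤ 1)
    (μ : Measure (EuclideanSpace ℝ (Fin N)))
    {H : ℝ} (hH : 0 < H) (s : ℝ) (hs : 1 ≤ s) :
    ∫⁻ x, (∑' k : ℕ, (wrG γ μ (H / 2 ^ k) x) ^ a) ^ (s / a) ≤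
      (wrC N γ a * ENNReal.ofReal (s / a)) ^ (s / a) *
        ∫⁻ x, (⨆ k : ℕ, wrG γ μ (H / 2 ^ k) x) ^ s := by
  have hcm : ∀ j, Measurable fun x => (wrG γ μ (H / 2 ^ j) x) ^ a := fun j =>
    (wrG_meas γ μ _).pow_const a
  have hGm : Measurable fun x => ⨆ k : ℕ, wrG γ μ (H / 2 ^ k) x :=
    Measurable.iSup fun k => wrG_meas γ μ _
  have hsa : 1 ≤ s / a := by rw [le_div_iff₀ ha]; linarith
  have base := fun n => wr_abs volume (fun k x => (wrG γ μ (H / 2 ^ k) x) ^ a) hcm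
    (fun x => (⨆ k : ℕ, wrG γ μ (H / 2 ^ k) x) ^ a) (hGm.pow_const a)
    (fun k x => ENNReal.rpow_le_rpow (le_iSup (fun k : ℕ => wrG γ μ (H / 2 ^ k) x) k) ha.le)
    (wrC N γ a) (wrC_ne_top γ a hγ ha) (fun k x => wrIdx (H / 2 ^ k) x)
    (fun j k hjk x y e => by
      rw [wrG_congr (wrIdx_coarse_congr H hjk e)])
    (fun k n d _ hd => wr_H γ a ha ha1 μ hH k n d hd) (s / a) hsa n
  simp only [← ENNReal.rpow_mul, mul_div_cancel₀ s ha.ne'] at base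
  have lim := lintegral_tendsto_of_tendsto_of_monotone
    (μ := (volume : Measure (EuclideanSpace ℝ (Fin N))))
    (f := fun n x => (∑ k ∈ Finset.range n, (wrG γ μ (H / 2 ^ k) x) ^ a) ^ (s / a))
    (F := fun x => (∑' k : ℕ, (wrG γ μ (H / 2 ^ k) x) ^ a) ^ (s / a))
    (fun n => ((Finset.measurable_fun_sum _ fun i _ => hcm i).pow_const _).aemeasurable)
    (Filter.Eventually.of_forall fun x n m hnm => ENNReal.rpow_le_rpow
      (Finset.sum_le_sum_of_subset (Finset.range_mono hnm)) (by linarith))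
    (Filter.Eventually.of_forall fun x =>
      ((ENNReal.continuous_rpow_const (y := s / a)).tendsto _).comp
        ENNReal.summable.hasSum.tendsto_sum_nat)
  exact le_of_tendsto' lim base

lemma wr_disc [Nonempty (Fin N)] (γ a : ℝ) (hγ : γ < N) (ha : 0 < a) :
    ∃ C : ℝ≥0∞, C ≠ ⊤ ∧ ∀ (μ : Measure (EuclideanSpace ℝ (Fin N)))
      (H : ℝ) (_ : 0 < H) (s : ℝ) (_ : 1 ≤ s),
    ∫⁻ x, (∑' k : ℕ, (wrG γ μ (H / 2 ^ k) x) ^ a) ^ (s / a) ≤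
      (C * ENNReal.ofReal s) ^ (s / a) *
        ∫⁻ x, (⨆ k : ℕ, wrG γ μ (H / 2 ^ k) x) ^ s := by
  rcases le_total a 1 with ha1 | ha1
  · refine ⟨wrC N γ a * ENNReal.ofReal (1 / a), ENNReal.mul_ne_top (wrC_ne_top γ a hγ ha)
      ENNReal.ofReal_ne_top, fun μ H hH s hs => ?_⟩
    refine (wr_disc1 γ a hγ ha ha1 μ hH s hs).trans (le_of_eq ?_)
    rw [mul_assoc, ← ENNReal.ofReal_mul (by positivity), one_div_mul_eq_div]
  · refine ⟨wrC N γ 1, wrC_ne_top γ 1 hγ one_pos, fun μ H hH s hs => ?_⟩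
    have h1 := wr_disc1 γ 1 hγ one_pos le_rfl μ hH s hs
    simp only [ENNReal.rpow_one, div_one] at h1
    set G := fun x => ⨆ k : ℕ, wrG γ μ (H / 2 ^ k) x with hG
    set A := fun x => ∑' k : ℕ, wrG γ μ (H / 2 ^ k) x with hA
    have hGm : Measurable G := Measurable.iSup fun k => wrG_meas γ μ _
    have hAm : Measurable A := Measurable.tsum fun k => wrG_meas γ μ _
    have hs0 : 0 < s := by linarith
    have hi : 1 / a ≤ 1 := by rw [div_le_one ha]; exact ha1
    have hi0 : 0 ≤ 1 / a := by positivity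
    have pt : ∀ x, (∑' k : ℕ, (wrG γ μ (H / 2 ^ k) x) ^ a) ^ (s / a) ≤
        ((G x) ^ s) ^ (1 - 1 / a) * ((A x) ^ s) ^ (1 / a) := by
      intro x
      have : ∑' k : ℕ, (wrG γ μ (H / 2 ^ k) x) ^ a ≤ (G x) ^ (a - 1) * A x := by
        rw [hA]; simp only
        rw [← ENNReal.tsum_mul_left]
        refine ENNReal.tsum_le_tsum fun k => ?_
        calc (wrG γ μ (H / 2 ^ k) x) ^ a
            = (wrG γ μ (H / 2 ^ k) x) ^ (a - 1) * wrG γ μ (H / 2 ^ k) x := by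
              conv_rhs => rw [← ENNReal.rpow_one (wrG γ μ (H / 2 ^ k) x), ← ENNReal.rpow_mul,
                ← ENNReal.rpow_add_of_nonneg _ _ (by linarith) (by norm_num)]
              congr 1; ring
          _ ≤ _ := by
              gcongr
              exact le_iSup (fun k : ℕ => wrG γ μ (H / 2 ^ k) x) k
      refine (ENNReal.rpow_le_rpow this (by positivity)).trans (le_of_eq ?_)
      rw [ENNReal.mul_rpow_of_nonneg _ _ (by positivity), ← ENNReal.rpow_mul, ← ENNReal.rpow_mul,
        ← ENNReal.rpow_mul]
      congr 2 <;> field_simp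
    calc _ ≤ ∫⁻ x, ((G x) ^ s) ^ (1 - 1 / a) * ((A x) ^ s) ^ (1 / a) := lintegral_mono pt
      _ ≤ (∫⁻ x, (G x) ^ s) ^ (1 - 1 / a) * (∫⁻ x, (A x) ^ s) ^ (1 / a) :=
          ENNReal.lintegral_mul_norm_pow_le (hGm.pow_const s).aemeasurable
            (hAm.pow_const s).aemeasurable (by linarith) hi0 (by ring)
      _ ≤ (∫⁻ x, (G x) ^ s) ^ (1 - 1 / a) *
          ((wrC N γ 1 * ENNReal.ofReal s) ^ s * ∫⁻ x, (G x) ^ s) ^ (1 / a) := by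
          gcongr
      _ = (wrC N γ 1 * ENNReal.ofReal s) ^ (s / a) * ((∫⁻ x, (G x) ^ s) ^ (1 - 1 / a) *
          (∫⁻ x, (G x) ^ s) ^ (1 / a)) := by
          rw [ENNReal.mul_rpow_of_nonneg _ _ hi0, ← ENNReal.rpow_mul, mul_one_div]; ring
      _ = _ := by
          rw [← ENNReal.rpow_add_of_nonneg _ _ (by linarith) hi0]; simp [hG]
end

noncomputable def wrP {X : Type*} [PseudoMetricSpace X] [MeasurableSpace X] (γ a : ℝ) (R : ℝ≥0∞)
    (μ : Measure X) (x : X) : ℝ≥0∞ :=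
  ∫⁻ t in {t : ℝ | 0 < t ∧ ENNReal.ofReal t < R},
    (μ (Metric.ball x t) / ENNReal.ofReal (t ^ γ)) ^ a * ENNReal.ofReal t⁻¹

lemma wr_lsc {X : Type*} [PseudoMetricSpace X] [MeasurableSpace X] (μ : Measure X) :
    LowerSemicontinuous fun z : X × ℝ => μ (Metric.ball z.1 z.2) := by
  rintro ⟨x, t⟩ y hy
  have hU : Metric.ball x t = ⋃ n : ℕ, Metric.ball x (t - 1 / ((n:ℝ) + 1)) := by
    ext w
    simp only [Metric.mem_ball, Set.mem_iUnion]
    constructor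
    · intro h
      obtain ⟨n, hn⟩ := exists_nat_one_div_lt (sub_pos.mpr h)
      exact ⟨n, by linarith⟩
    · rintro ⟨n, hn⟩
      have : 0 < 1 / ((n:ℝ) + 1) := by positivity
      linarith
  have hmono : Monotone fun n : ℕ => Metric.ball x (t - 1 / ((n:ℝ) + 1)) := by
    intro n m hnm
    apply Metric.ball_subset_ball
    have : 1 / ((m:ℝ) + 1) ≤ 1 / ((n:ℝ) + 1) := one_div_le_one_div_of_le (by positivity)
      (by have : (n:ℝ) ≤ m := by exact_mod_cast hnm
          linarith)
    linarith
  change y < μ (Metric.ball x t) at hy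
  rw [hU, hmono.measure_iUnion, lt_iSup_iff] at hy
  obtain ⟨n, hn⟩ := hy
  set ε := 1 / ((n:ℝ) + 1) with hε
  have hε0 : 0 < ε := by positivity
  filter_upwards [Metric.ball_mem_nhds (x, t) (half_pos hε0)] with z hz
  refine hn.trans_le (measure_mono fun w hw => ?_)
  rw [Metric.mem_ball, Prod.dist_eq, max_lt_iff] at hz
  obtain ⟨h1, h2⟩ := hz
  rw [Real.dist_eq, abs_lt] at h2
  simp only at h1 h2
  rw [Metric.mem_ball] at hw ⊢
  have := dist_triangle w x z.1
  rw [dist_comm x] at this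
  linarith [h2.1]

lemma wrP_meas {X : Type*} [PseudoMetricSpace X] [SecondCountableTopology X] [MeasurableSpace X]
    [OpensMeasurableSpace X] (γ a : ℝ) (R : ℝ≥0∞) (μ : Measure X) : Measurable (wrP γ a R μ) := by
  have h := (wr_lsc μ).measurable
  unfold wrP
  refine Measurable.lintegral_prod_right' (f := fun z : X × ℝ =>
    (μ (Metric.ball z.1 z.2) / ENNReal.ofReal (z.2 ^ γ)) ^ a * ENNReal.ofReal z.2⁻¹) ?_
  refine ((h.div ?_).pow_const a).mul ?_
  · exact (measurable_snd.pow_const γ).ennreal_ofReal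
  · exact measurable_snd.inv.ennreal_ofReal

lemma wrP_mono {X : Type*} [PseudoMetricSpace X] [MeasurableSpace X] (γ a : ℝ) {R R' : ℝ≥0∞}
    (h : R ≤ R') (μ : Measure X) (x : X) : wrP γ a R μ x ≤ wrP γ a R' μ x :=
  lintegral_mono_set fun _ ht => ⟨ht.1, ht.2.trans_le h⟩

lemma wrP_lim {X : Type*} [PseudoMetricSpace X] [MeasurableSpace X] (γ a : ℝ)
    (μ : Measure X) (x : X) :
    Filter.Tendsto (fun n : ℕ => wrP γ a (ENNReal.ofReal ((n:ℝ) + 1)) μ x) Filter.atTop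
      (nhds (wrP γ a ⊤ μ x)) := by
  have hm : Monotone fun n : ℕ => wrP γ a (ENNReal.ofReal ((n:ℝ) + 1)) μ x := fun n m hnm =>
    wrP_mono γ a (ENNReal.ofReal_le_ofReal (by gcongr)) μ x
  have : wrP γ a ⊤ μ x = ⨆ n : ℕ, wrP γ a (ENNReal.ofReal ((n:ℝ) + 1)) μ x := by
    unfold wrP
    rw [← setLIntegral_iUnion_of_directed]
    · congr 2
      ext t
      simp only [Set.mem_ofPred_eq, Set.mem_iUnion]
      constructor
      · rintro ⟨h, -⟩
        obtain ⟨n, hn⟩ := exists_nat_gt t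
        exact ⟨n, h, (ENNReal.ofReal_lt_ofReal_iff (by positivity)).mpr (by linarith)⟩
      · rintro ⟨n, h, -⟩
        exact ⟨h, ENNReal.ofReal_lt_top⟩
    · refine Monotone.directed_le ?_
      intro n m hnm t ht
      exact ⟨ht.1, ht.2.trans_le (ENNReal.ofReal_le_ofReal (by gcongr))⟩
  rw [this]
  exact tendsto_atTop_iSup hm

lemma wr_div_eq (m : ℝ≥0∞) {t : ℝ} (ht : 0 < t) (γ : ℝ) :
    m / ENNReal.ofReal (t ^ γ) = m * ENNReal.ofReal (t ^ (-γ)) := by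
  rw [div_eq_mul_inv, ← ENNReal.ofReal_inv_of_pos (by positivity), Real.rpow_neg ht.le]

section
variable {N : ℕ}

/-- lower bound of the potential by one scale -/
lemma wr_low (γ b : ℝ) (hγ : 0 < γ) (hb : 0 < b) (μ : Measure (EuclideanSpace ℝ (Fin N)))
    {R h : ℝ} (hh : 0 < h) (hR : 2 * (2 * N + 1) * h ≤ R) (x : EuclideanSpace ℝ (Fin N)) :
    (wrG γ μ h x) ^ b ≤ ENNReal.ofReal (2 * (2 * (2 * N + 1)) ^ (γ * b)) *
      wrP γ b (ENNReal.ofReal R) μ x := by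
  set D : ℝ := 2 * N + 1 with hD
  have hD0 : 0 < D := by positivity
  have hDh : 0 < D * h := by positivity
  have hlow : (wrG γ μ h x * ENNReal.ofReal ((2 * D) ^ (-γ))) ^ b * ENNReal.ofReal (1/2) ≤
      wrP γ b (ENNReal.ofReal R) μ x := by
    have hsub : Set.Ioo (D * h) (2 * D * h) ⊆ {t : ℝ | 0 < t ∧ ENNReal.ofReal t < ENNReal.ofReal R} := by
      intro t ht
      have := ht.1; have := ht.2
      refine ⟨by linarith, (ENNReal.ofReal_lt_ofReal_iff (by linarith)).mpr (by linarith)⟩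
    refine le_trans ?_ (lintegral_mono_set hsub)
    calc _ = ∫⁻ t in Set.Ioo (D * h) (2 * D * h),
          (wrG γ μ h x * ENNReal.ofReal ((2 * D) ^ (-γ))) ^ b * ENNReal.ofReal (2 * D * h)⁻¹ := by
          rw [setLIntegral_const, Real.volume_Ioo, mul_assoc, ← ENNReal.ofReal_mul (by positivity)]
          congr 2; field_simp; ring
      _ ≤ _ := by
          refine setLIntegral_mono' measurableSet_Ioo fun t ht => ?_
          have ht1 := ht.1
          have ht2 := ht.2
          have ht0 : 0 < t := by linarith
          rw [wr_div_eq _ ht0]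
          refine mul_le_mul' (ENNReal.rpow_le_rpow ?_ hb.le)
            (ENNReal.ofReal_le_ofReal (inv_anti₀ ht0 ht2.le))
          unfold wrG
          rw [mul_assoc, ← ENNReal.ofReal_mul (by positivity)]
          gcongr ?_ * ENNReal.ofReal ?_
          · exact measure_mono ((wr_sub_ball hh x).trans (Metric.ball_subset_ball ht1.le))
          · rw [← Real.mul_rpow hh.le (by positivity)]
            exact Real.rpow_le_rpow_of_nonpos ht0 (by linarith) (by linarith)
  refine le_trans (le_of_eq ?_) (mul_le_mul_right hlow _)
  rw [ENNReal.mul_rpow_of_nonneg _ _ hb.le, ENNReal.ofReal_rpow_of_pos (by positivity)]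
  have : ENNReal.ofReal (2 * (2 * D) ^ (γ * b)) * (ENNReal.ofReal (((2 * D) ^ (-γ)) ^ b) * ENNReal.ofReal (1/2)) = 1 := by
    rw [← ENNReal.ofReal_mul (by positivity), ← ENNReal.ofReal_mul (by positivity),
      ← Real.rpow_mul (by positivity), neg_mul, Real.rpow_neg (by positivity)]
    rw [← ENNReal.ofReal_one]; congr 1; field_simp
  calc _ = (wrG γ μ h x) ^ b * 1 := by rw [mul_one]
    _ = _ := by rw [← this]; ring

/-- upper bound of the potential by the dyadic sum -/
lemma wr_up (γ a : ℝ) (hγ : 0 < γ) (ha : 0 < a) (μ : Measure (EuclideanSpace ℝ (Fin N)))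
    {R H : ℝ} (hH : 0 < H) (x : EuclideanSpace ℝ (Fin N)) :
    wrP γ a (ENNReal.ofReal R) μ x ≤
      (ENNReal.ofReal (2 ^ γ)) ^ a * ∑' k : ℕ, (wrG γ μ (H / 2 ^ k) x) ^ a +
      ENNReal.ofReal (R / H) * (μ (Metric.ball x R) * ENNReal.ofReal (H ^ (-γ))) ^ a := by
  have hsub : {t : ℝ | 0 < t ∧ ENNReal.ofReal t < ENNReal.ofReal R} ⊆
      (⋃ k : ℕ, Set.Ioc (H / 2 ^ k / 2) (H / 2 ^ k)) ∪ Set.Ioo H R := by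
    rintro t ⟨ht0, htR⟩
    have htR' : t < R := (ENNReal.ofReal_lt_ofReal_iff'.mp htR).1
    rcases le_or_gt t H with h | h
    · left
      obtain ⟨k, hk1, hk2⟩ := exists_nat_pow_near (x := H / t) (y := 2)
        (by rw [le_div_iff₀ ht0]; linarith) (by norm_num)
      rw [Set.mem_iUnion]
      refine ⟨k, ?_, ?_⟩
      · rw [div_div, ← pow_succ, div_lt_iff₀ (by positivity)]
        rw [div_lt_iff₀ ht0] at hk2; linarith
      · rw [le_div_iff₀ (by positivity)]
        rw [le_div_iff₀ ht0] at hk1; linarith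
    · right; exact ⟨h, htR'⟩
  unfold wrP
  refine (lintegral_mono_set hsub).trans ((lintegral_union_le _ _ _).trans ?_)
  refine add_le_add ((lintegral_iUnion_le _ _).trans ?_) ?_
  · rw [← ENNReal.tsum_mul_left]
    refine ENNReal.tsum_le_tsum fun k => ?_
    set h := H / 2 ^ k
    have hh : 0 < h := by positivity
    calc _ ≤ ∫⁻ t in Set.Ioc (h / 2) h,
          (ENNReal.ofReal (2 ^ γ) * wrG γ μ h x) ^ a * ENNReal.ofReal (h / 2)⁻¹ := by
          refine setLIntegral_mono' measurableSet_Ioc fun t ht => ?_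
          have ht1 := ht.1
          have ht2 := ht.2
          have hh2 : 0 < h / 2 := by positivity
          have ht0 : 0 < t := by linarith
          rw [wr_div_eq _ ht0]
          refine mul_le_mul' (ENNReal.rpow_le_rpow ?_ ha.le)
            (ENNReal.ofReal_le_ofReal (inv_anti₀ hh2 ht1.le))
          unfold wrG
          rw [mul_left_comm, ← ENNReal.ofReal_mul (by positivity)]
          gcongr ?_ * ENNReal.ofReal ?_
          · exact measure_mono (wr_ball_sub hh ht2 x)
          · refine (Real.rpow_le_rpow_of_nonpos hh2 ht1.le (by linarith)).trans (le_of_eq ?_)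
            rw [Real.div_rpow hh.le (by norm_num), Real.rpow_neg (by norm_num : (0:ℝ) ≤ 2)]
            field_simp
      _ = _ := by
          rw [setLIntegral_const, Real.volume_Ioc, mul_assoc, ← ENNReal.ofReal_mul (by positivity),
            show (h/2)⁻¹ * (h - h/2) = 1 by field_simp; ring, ENNReal.ofReal_one, mul_one,
            ENNReal.mul_rpow_of_nonneg _ _ ha.le]
  · calc _ ≤ ∫⁻ t in Set.Ioo H R,
          (μ (Metric.ball x R) * ENNReal.ofReal (H ^ (-γ))) ^ a * ENNReal.ofReal H⁻¹ := by
          refine setLIntegral_mono' measurableSet_Ioo fun t ht => ?_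
          have ht1 := ht.1
          have ht2 := ht.2
          have ht0 : 0 < t := by linarith
          rw [wr_div_eq _ ht0]
          gcongr ((?_ * ENNReal.ofReal ?_) ^ a) * ENNReal.ofReal ?_
          · exact measure_mono (Metric.ball_subset_ball ht2.le)
          · exact Real.rpow_le_rpow_of_nonpos hH ht1.le (by linarith)
          · gcongr
      _ ≤ _ := by
          rw [setLIntegral_const, Real.volume_Ioo, mul_assoc, ← ENNReal.ofReal_mul (by positivity),
            mul_comm]
          gcongr
          rw [inv_mul_eq_div]; gcongr; linarith

/-- covering of the big ball by translates -/
lemma wr_cov (γ : ℝ) (D : ℝ) : ∃ Z : Finset (EuclideanSpace ℝ (Fin N)),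
    ∀ (μ : Measure (EuclideanSpace ℝ (Fin N))) (H : ℝ) (_ : 0 < H)
      (x : EuclideanSpace ℝ (Fin N)),
      μ (Metric.ball x (D * H)) * ENNReal.ofReal (H ^ (-γ)) ≤
        ∑ z ∈ Z, wrG γ μ H (x + H • z) := by
  obtain ⟨t, -, htf, hc⟩ := (isCompact_closedBall (0 : EuclideanSpace ℝ (Fin N)) D).finite_cover_balls
    one_pos
  refine ⟨htf.toFinset, fun μ H hH x => ?_⟩
  unfold wrG
  rw [← Finset.sum_mul]
  gcongr
  refine le_trans (measure_mono ?_) (measure_biUnion_finset_le _ _)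
  intro y hy
  rw [Metric.mem_ball, dist_eq_norm] at hy
  have hy' : H⁻¹ • (y - x) ∈ Metric.closedBall (0 : EuclideanSpace ℝ (Fin N)) D := by
    rw [mem_closedBall_zero_iff, norm_smul, norm_inv, Real.norm_eq_abs, abs_of_pos hH,
      inv_mul_le_iff₀ hH]; linarith
  obtain ⟨z, hz, hyz⟩ := Set.mem_iUnion₂.mp (hc hy')
  refine Set.mem_iUnion₂.mpr ⟨z, by simpa using hz, wr_ball_sub hH le_rfl _ ?_⟩
  rw [Metric.mem_ball, dist_eq_norm] at hyz ⊢
  have e : y - (x + H • z) = H • (H⁻¹ • (y - x) - z) := by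
    rw [smul_sub, smul_inv_smul₀ hH.ne']; abel
  rw [e, norm_smul, Real.norm_eq_abs, abs_of_pos hH]
  nlinarith

lemma wr_add_rpow (u v : ℝ≥0∞) {r : ℝ} (hr : 0 < r) :
    (u + v) ^ r ≤ 2 ^ r * (u ^ r + v ^ r) := by
  rcases le_total u v with h | h
  · calc (u + v) ^ r ≤ (2 * v) ^ r := by rw [two_mul]; gcongr
      _ = 2 ^ r * v ^ r := ENNReal.mul_rpow_of_nonneg _ _ hr.le
      _ ≤ _ := by gcongr; exact le_add_self
  · calc (u + v) ^ r ≤ (2 * u) ^ r := by rw [two_mul]; gcongr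
      _ = 2 ^ r * u ^ r := ENNReal.mul_rpow_of_nonneg _ _ hr.le
      _ ≤ _ := by gcongr; exact le_self_add

lemma wr_main_fin [Nonempty (Fin N)] (γ a b : ℝ) (hγ0 : 0 < γ) (hγ : γ < N) (ha : 0 < a)
    (hb : 0 < b) : ∃ C : ℝ≥0∞, C ≠ ⊤ ∧ ∀ (R : ℝ) (_ : 0 < R)
      (μ : Measure (EuclideanSpace ℝ (Fin N))) (s : ℝ) (_ : 1 ≤ s),
      ∫⁻ x, (wrP γ a (ENNReal.ofReal R) μ x) ^ (s / a) ≤ (C * ENNReal.ofReal s) ^ (s / a) *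
        ∫⁻ x, (wrP γ b (ENNReal.ofReal R) μ x) ^ (s / b) := by
  obtain ⟨C, hC, hdisc⟩ := wr_disc (N := N) γ a hγ ha
  set D : ℝ := 2 * (2 * N + 1) with hD
  have hD0 : 0 < D := by positivity
  obtain ⟨Z, hZ⟩ := wr_cov (N := N) γ D
  set K : ℝ≥0∞ := ENNReal.ofReal (2 * D ^ (γ * b)) with hK
  set U : ℝ≥0∞ := (ENNReal.ofReal (2 ^ γ)) ^ a with hU
  have hUt : U ≠ ⊤ := ENNReal.rpow_ne_top_of_nonneg ha.le ENNReal.ofReal_ne_top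
  set W : ℝ≥0∞ := ENNReal.ofReal D * (Z.card : ℝ≥0∞) ^ a with hW
  have hWt : W ≠ ⊤ := ENNReal.mul_ne_top ENNReal.ofReal_ne_top
    (ENNReal.rpow_ne_top_of_nonneg ha.le (by simp))
  refine ⟨2 * 2 ^ a * (U * C + W) * K ^ (a / b), ?_, fun R hR μ s hs => ?_⟩
  · refine ENNReal.mul_ne_top (ENNReal.mul_ne_top (ENNReal.mul_ne_top (by simp)
      (ENNReal.rpow_ne_top_of_nonneg ha.le (by simp))) (ENNReal.add_ne_top.mpr
        ⟨ENNReal.mul_ne_top hUt hC, hWt⟩)) ?_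
    exact ENNReal.rpow_ne_top_of_nonneg (by positivity) ENNReal.ofReal_ne_top
  have hs0 : 0 < s := by linarith
  set r := s / a with hr
  have hr0 : 0 < r := by positivity
  have har : a * r = s := by rw [hr]; field_simp
  set H := R / D with hHd
  have hH : 0 < H := by positivity
  have hRH : R = D * H := by rw [hHd]; field_simp
  have hRH' : R / H = D := by rw [hRH]; field_simp
  set G := fun x => ⨆ k : ℕ, wrG γ μ (H / 2 ^ k) x with hG
  have hGm : Measurable G := Measurable.iSup fun k => wrG_meas γ μ _
  set A := fun x => ∑' k : ℕ, (wrG γ μ (H / 2 ^ k) x) ^ a with hA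
  have hAm : Measurable A := Measurable.tsum fun k => (wrG_meas γ μ _).pow_const a
  set S := fun x => ∑ z ∈ Z, wrG γ μ H (x + H • z) with hS
  have hSm : Measurable S := Finset.measurable_fun_sum _ fun z _ =>
    (wrG_meas γ μ H).comp (measurable_id.add_const _)
  have hGs : ∫⁻ x, (G x) ^ s ≤ K ^ (s / b) * ∫⁻ x, (wrP γ b (ENNReal.ofReal R) μ x) ^ (s / b) := by
    rw [← lintegral_const_mul' _ _ (ENNReal.rpow_ne_top_of_nonneg (by positivity) ENNReal.ofReal_ne_top)]
    refine lintegral_mono fun x => ?_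
    simp only
    rw [← ENNReal.mul_rpow_of_nonneg _ _ (by positivity)]
    have h1 : G x ≤ (K * wrP γ b (ENNReal.ofReal R) μ x) ^ (1 / b) := by
      refine iSup_le fun k => ?_
      rw [one_div, ENNReal.le_rpow_inv_iff hb]
      refine wr_low γ b hγ0 hb μ (by positivity) ?_ x
      rw [hRH]
      gcongr
      exact div_le_self hH.le (one_le_pow₀ (by norm_num))
    refine (ENNReal.rpow_le_rpow h1 hs0.le).trans (le_of_eq ?_)
    rw [← ENNReal.rpow_mul, one_div_mul_eq_div]
  have hSs : ∫⁻ x, (S x) ^ s ≤ (Z.card : ℝ≥0∞) ^ s * ∫⁻ x, (G x) ^ s := by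
    calc ∫⁻ x, (S x) ^ s ≤ ∫⁻ x, (Z.card : ℝ≥0∞) ^ (s - 1) * ∑ z ∈ Z, (wrG γ μ H (x + H • z)) ^ s :=
          lintegral_mono fun x => ENNReal.rpow_sum_le_const_mul_sum_rpow _ _ hs
      _ = (Z.card : ℝ≥0∞) ^ (s - 1) * ∑ z ∈ Z, ∫⁻ x, (wrG γ μ H (x + H • z)) ^ s := by
          rw [lintegral_const_mul' _ _ (ENNReal.rpow_ne_top_of_nonneg (by linarith) (by simp)),
            lintegral_finsetSum]
          intro z _
          exact ((wrG_meas γ μ H).comp (measurable_id.add_const _)).pow_const s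
      _ = (Z.card : ℝ≥0∞) ^ (s - 1) * ∑ z ∈ Z, ∫⁻ x, (wrG γ μ H x) ^ s := by
          congr 1
          refine Finset.sum_congr rfl fun z _ => ?_
          exact lintegral_add_right_eq_self (fun x => (wrG γ μ H x) ^ s) (H • z)
      _ = (Z.card : ℝ≥0∞) ^ s * ∫⁻ x, (wrG γ μ H x) ^ s := by
          rw [Finset.sum_const, nsmul_eq_mul, ← mul_assoc]
          congr 1
          conv_lhs => rw [← ENNReal.rpow_one (Z.card : ℝ≥0∞), ← ENNReal.rpow_mul,
            ← ENNReal.rpow_add_of_nonneg _ _ (by linarith) (by norm_num)]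
          congr 1; ring
      _ ≤ _ := by
          gcongr with x
          have := le_iSup (fun k : ℕ => wrG γ μ (H / 2 ^ k) x) 0
          simpa using this
  have hpt : ∀ x, (wrP γ a (ENNReal.ofReal R) μ x) ^ r ≤
      2 ^ r * (U ^ r * (A x) ^ r + (ENNReal.ofReal D) ^ r * (S x) ^ s) := by
    intro x
    have h1 := wr_up γ a hγ0 ha μ (R := R) hH x
    rw [hRH'] at h1
    have h2 : wrP γ a (ENNReal.ofReal R) μ x ≤ U * A x + ENNReal.ofReal D * (S x) ^ a := by
      refine h1.trans ?_
      gcongr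
      have := hZ μ H hH x
      rwa [← hRH] at this
    refine (ENNReal.rpow_le_rpow h2 hr0.le).trans ((wr_add_rpow _ _ hr0).trans (le_of_eq ?_))
    rw [ENNReal.mul_rpow_of_nonneg _ _ hr0.le, ENNReal.mul_rpow_of_nonneg _ _ hr0.le,
      ← ENNReal.rpow_mul (S x), har]
  have hs1 : 1 ≤ ENNReal.ofReal s := by rw [← ENNReal.ofReal_one]; exact ENNReal.ofReal_le_ofReal hs
  set Y := ∫⁻ x, (G x) ^ s
  set σ := ENNReal.ofReal s
  calc ∫⁻ x, (wrP γ a (ENNReal.ofReal R) μ x) ^ r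
      ≤ ∫⁻ x, 2 ^ r * (U ^ r * (A x) ^ r + (ENNReal.ofReal D) ^ r * (S x) ^ s) :=
        lintegral_mono hpt
    _ = 2 ^ r * (U ^ r * (∫⁻ x, (A x) ^ r) + (ENNReal.ofReal D) ^ r * ∫⁻ x, (S x) ^ s) := by
        rw [lintegral_const_mul' _ _ (ENNReal.rpow_ne_top_of_nonneg hr0.le (by simp)),
          lintegral_add_left ((hAm.pow_const r).const_mul _),
          lintegral_const_mul _ (hAm.pow_const r), lintegral_const_mul _ (hSm.pow_const s)]
    _ ≤ 2 ^ r * (U ^ r * ((C * σ) ^ r * Y) + (ENNReal.ofReal D) ^ r * ((Z.card : ℝ≥0∞) ^ s * Y)) := by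
        gcongr
        exact hdisc μ H hH s hs
    _ = 2 ^ r * ((U * C * σ) ^ r + W ^ r) * Y := by
        rw [hW, ENNReal.mul_rpow_of_nonneg (ENNReal.ofReal D) _ hr0.le, ← ENNReal.rpow_mul (Z.card : ℝ≥0∞), har,
          mul_assoc U, ENNReal.mul_rpow_of_nonneg U _ hr0.le]
        ring
    _ ≤ 2 ^ r * (((U * C + W) * σ) ^ r + ((U * C + W) * σ) ^ r) * Y := by
        gcongr
        · exact le_self_add
        · calc W ≤ U * C + W := le_add_self
            _ = (U * C + W) * 1 := (mul_one _).symm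
            _ ≤ _ := by gcongr
    _ = 2 ^ r * (2 * ((U * C + W) * σ) ^ r) * Y := by rw [two_mul]
    _ ≤ 2 ^ r * ((2 ^ a) ^ r * ((U * C + W) * σ) ^ r) * Y := by
        gcongr
        rw [← ENNReal.rpow_mul, har]
        conv_lhs => rw [← ENNReal.rpow_one 2]
        exact ENNReal.rpow_le_rpow_of_exponent_le (by norm_num) hs
    _ ≤ 2 ^ r * ((2 ^ a) ^ r * ((U * C + W) * σ) ^ r) *
          ((K ^ (a / b)) ^ r * ∫⁻ x, (wrP γ b (ENNReal.ofReal R) μ x) ^ (s / b)) := by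
        gcongr
        rw [← ENNReal.rpow_mul, show a / b * r = s / b by rw [← har]; ring]
        exact hGs
    _ = _ := by
        rw [show 2 * 2 ^ a * (U * C + W) * K ^ (a / b) * σ =
          2 * (2 ^ a * (((U * C + W) * σ) * K ^ (a / b))) by ring]
        simp only [ENNReal.mul_rpow_of_nonneg _ _ hr0.le]
        ring

lemma wr_main [Nonempty (Fin N)] (γ a b : ℝ) (hγ0 : 0 < γ) (hγ : γ < N) (ha : 0 < a)
    (hb : 0 < b) : ∃ C : ℝ≥0∞, C ≠ ⊤ ∧ ∀ (R : ℝ≥0∞) (_ : 0 < R)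
      (μ : Measure (EuclideanSpace ℝ (Fin N))) (s : ℝ) (_ : 1 ≤ s),
      ∫⁻ x, (wrP γ a R μ x) ^ (s / a) ≤ (C * ENNReal.ofReal s) ^ (s / a) *
        ∫⁻ x, (wrP γ b R μ x) ^ (s / b) := by
  obtain ⟨C, hC, h⟩ := wr_main_fin (N := N) γ a b hγ0 hγ ha hb
  refine ⟨C, hC, fun R hR μ s hs => ?_⟩
  have hs0 : 0 < s := by linarith
  by_cases hRt : R = ⊤
  · subst hRt
    have lim := lintegral_tendsto_of_tendsto_of_monotone
      (μ := (volume : Measure (EuclideanSpace ℝ (Fin N))))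
      (f := fun n x => (wrP γ a (ENNReal.ofReal ((n:ℝ) + 1)) μ x) ^ (s / a))
      (F := fun x => (wrP γ a ⊤ μ x) ^ (s / a))
      (fun n => ((wrP_meas γ a _ μ).pow_const _).aemeasurable)
      (Filter.Eventually.of_forall fun x n m hnm => ENNReal.rpow_le_rpow
        (wrP_mono γ a (ENNReal.ofReal_le_ofReal (by gcongr)) μ x) (by positivity))
      (Filter.Eventually.of_forall fun x =>
        ((ENNReal.continuous_rpow_const (y := s / a)).tendsto _).comp (wrP_lim γ a μ x))
    refine le_of_tendsto' lim fun n => (h _ (by positivity) μ s hs).trans ?_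
    gcongr with x
    exact wrP_mono γ b le_top μ x
  · have := h R.toReal (ENNReal.toReal_pos hR.ne' hRt) μ s hs
    rwa [ENNReal.ofReal_toReal hRt] at this
end
theorem wolff_riesz_Lq_equivalence (N : ℕ) (α p : ℝ)
    (hα : 0 < α) (hp : 1 < p) (hαp : α * p < N) :
    ∃ c₁ : ℝ, 0 < c₁ ∧ ∀ (R : ℝ≥0∞), 0 < R →
      ∀ (μ : Measure (EuclideanSpace ℝ (Fin N))) (q : ℝ), p - 1 ≤ q →
        ENNReal.ofReal ((c₁ * q) ^ (-(q / (p - 1)))) *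
            ∫⁻ x, (rieszE N α p R μ x) ^ (q / (p - 1)) ≤
          (∫⁻ x, (wolffE N α p R μ x) ^ q) ∧
        (∫⁻ x, (wolffE N α p R μ x) ^ q) ≤
          ENNReal.ofReal ((c₁ * q) ^ q) *
            ∫⁻ x, (rieszE N α p R μ x) ^ (q / (p - 1)) := by
  have hp1 : 0 < p - 1 := by linarith
  have hαp0 : 0 < α * p := by positivity
  have hN : N ≠ 0 := by
    rintro rfl
    simp only [Nat.cast_zero] at hαp
    linarith
  have : Nonempty (Fin N) := ⟨⟨0, Nat.pos_of_ne_zero hN⟩⟩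
  have hγ0 : 0 < (N:ℝ) - α * p := by linarith
  have hγ : (N:ℝ) - α * p < N := by linarith
  have hm : 0 < 1 / (p - 1) := by positivity
  obtain ⟨C1, hC1, h1⟩ := wr_main (N := N) _ 1 (1 / (p - 1)) hγ0 hγ one_pos hm
  obtain ⟨C2, hC2, h2⟩ := wr_main (N := N) _ (1 / (p - 1)) 1 hγ0 hγ hm one_pos
  set c : ℝ := C1.toReal + C2.toReal + 1 with hc
  have hc0 : 0 < c := by positivity
  have hcC1 : C1 ≤ ENNReal.ofReal c := by
    rw [← ENNReal.ofReal_toReal hC1]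
    apply ENNReal.ofReal_le_ofReal
    have := C2.toReal_nonneg; linarith
  have hcC2 : C2 ≤ ENNReal.ofReal c := by
    rw [← ENNReal.ofReal_toReal hC2]
    apply ENNReal.ofReal_le_ofReal
    have := C1.toReal_nonneg; linarith
  refine ⟨c / (p - 1), by positivity, fun R hR μ q hq => ?_⟩
  have hq0 : 0 < q := by linarith
  set s := q / (p - 1) with hs
  have hs1 : 1 ≤ s := by rw [hs, le_div_iff₀ hp1]; linarith
  have hs0 : 0 < s := by linarith
  have hcq : c / (p - 1) * q = c * s := by rw [hs]; ring
  have hcs : 0 < c * s := by positivity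
  have hsm : s / (1 / (p - 1)) = q := by rw [hs]; field_simp
  have hI : ∀ x, wrP ((N:ℝ) - α * p) 1 R μ x = rieszE N α p R μ x := by
    intro x; unfold wrP rieszE; simp only [ENNReal.rpow_one]
  have hW : ∀ x, wrP ((N:ℝ) - α * p) (1 / (p - 1)) R μ x = wolffE N α p R μ x := fun x => rfl
  have h1' := h1 R hR μ s hs1
  have h2' := h2 R hR μ s hs1
  simp only [hI, hW, hsm, div_one] at h1' h2'
  rw [hcq]
  constructor
  · have h3 : ∫⁻ x, (rieszE N α p R μ x) ^ s ≤
        ENNReal.ofReal ((c * s) ^ s) * ∫⁻ x, (wolffE N α p R μ x) ^ q := by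
      refine h1'.trans ?_
      rw [← ENNReal.ofReal_rpow_of_pos hcs, ENNReal.ofReal_mul hc0.le]
      gcongr
    calc _ ≤ ENNReal.ofReal ((c * s) ^ (-s)) *
          (ENNReal.ofReal ((c * s) ^ s) * ∫⁻ x, (wolffE N α p R μ x) ^ q) := by gcongr
      _ = _ := by
        rw [← mul_assoc, ← ENNReal.ofReal_mul (by positivity), ← Real.rpow_add hcs]
        simp
  · refine h2'.trans ?_
    rw [← ENNReal.ofReal_rpow_of_pos hcs, ENNReal.ofReal_mul hc0.le]
    gcongr
end

section
/- Let α > 0, p > 1 with 0 < αp < N, and 0 < R ≤ ∞. There exists a constant c depending only on N, α, p such that for every nonnegative Radon measure μ on ℝ^N and every q ≥ p−1: ∫_{ℝ^N} (M_{αp,R}[μ](x))^{q/(p−1)} dx ≥ (c q)^{−q} ∫_{ℝ^N} (W_{α,p}^R[μ](x))^q dx, where M_{αp,R}[μ](x) = sup_{0<t≤R} μ(B_t(x))/t^{N−αp} is the truncated fractional maximal function. -/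
open MeasureTheory ENNReal

/-- The `R`-truncated fractional maximal function
`M_{αp,R}[μ](x) = sup_{0<t, t<R} μ(B_t(x))/t^{N-αp}` (with `R = ∞` allowed). -/
noncomputable def fracMax (N : ℕ) (α p : ℝ) (R : ℝ≥0∞)
    (μ : Measure (EuclideanSpace ℝ (Fin N))) (x : EuclideanSpace ℝ (Fin N)) : ℝ≥0∞ :=
  ⨆ (t : ℝ) (_ : 0 < t ∧ ENNReal.ofReal t ≤ R),
    μ (Metric.ball x t) / ENNReal.ofReal (t ^ ((N : ℝ) - α * p))


lemma wf_convex (s a : ℝ≥0∞) {q : ℝ} (hq : 1 ≤ q) :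
    (s + a) ^ q ≤ s ^ q + ENNReal.ofReal q * (a * (s + a) ^ (q - 1)) := by
  have hq0 : 0 < q := by linarith
  by_cases hs : s = ∞
  · simp [hs, hq0]
  by_cases ha : a = ∞
  · have : ENNReal.ofReal q * (a * (s + a) ^ (q - 1)) = ∞ := by
      subst ha
      rcases eq_or_lt_of_le hq with h | h
      · subst h; simp
      · have : 0 < q - 1 := by linarith
        simp [this, ENNReal.mul_top, hq0]
    simp [this]
  lift s to NNReal using hs
  lift a to NNReal using ha
  have key : ((s + a : NNReal) : ℝ) ^ q ≤ (s : ℝ) ^ q + q * (a * ((s + a : NNReal) : ℝ) ^ (q - 1)) := by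
    rcases eq_or_lt_of_le (zero_le : 0 ≤ s + a) with h | h
    · have h1 : s + a = 0 := h.symm
      simp only [add_eq_zero] at h1
      simp [h1.1, h1.2, hq0.ne']
    · have hT : 0 < ((s + a : NNReal) : ℝ) := by exact_mod_cast h
      set T : ℝ := ((s + a : NNReal) : ℝ) with hTd
      have hTe : T = s + a := by simp [hTd]
      have hs0 : (0:ℝ) ≤ s := s.2
      have ha0 : (0:ℝ) ≤ a := a.2
      have hu : -1 ≤ -((a:ℝ) / T) := by
        have : (a:ℝ) / T ≤ 1 := by rw [div_le_one hT]; linarith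
        linarith
      have b := one_add_mul_self_le_rpow_one_add hu hq
      have e1 : 1 + -((a:ℝ)/T) = s / T := by field_simp; linarith
      rw [e1, Real.div_rpow hs0 hT.le] at b
      have hTq : 0 < T ^ q := Real.rpow_pos_of_pos hT q
      rw [le_div_iff₀ hTq] at b
      have e2 : T ^ (q - 1) = T ^ q / T := by rw [Real.rpow_sub hT, Real.rpow_one]
      rw [e2]
      have e3 : (1 + q * -((a:ℝ) / T)) * T ^ q = T ^ q - q * (a * (T ^ q / T)) := by ring
      linarith
  have h2 : (s + a) ^ q ≤ s ^ q + q.toNNReal * (a * (s + a) ^ (q - 1)) := by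
    rw [← NNReal.coe_le_coe]
    push_cast
    rw [Real.coe_toNNReal _ hq0.le]
    exact_mod_cast key
  have h3 : (((s + a) ^ q : NNReal) : ℝ≥0∞) ≤ ((s ^ q + q.toNNReal * (a * (s + a) ^ (q - 1)) : NNReal) : ℝ≥0∞) := by
    exact_mod_cast h2
  rw [ENNReal.ofReal, ← ENNReal.coe_add, ← ENNReal.coe_rpow_of_nonneg _ hq0.le,
    ← ENNReal.coe_rpow_of_nonneg _ hq0.le, ← ENNReal.coe_rpow_of_nonneg _ (by linarith)]
  exact_mod_cast h2

lemma wf_lint_fiber {X I : Type*} [MeasurableSpace X] (ν : Measure X) [Countable I]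
    [MeasurableSpace I] [DiscreteMeasurableSpace I] (φ : X → I) (hφ : Measurable φ)
    (F : X → ℝ≥0∞) : ∫⁻ x, F x ∂ν = ∑' i, ∫⁻ x in φ ⁻¹' {i}, F x ∂ν := by
  rw [← lintegral_iUnion (fun i => hφ (measurableSet_singleton i))]
  · have : (⋃ i, φ ⁻¹' {i}) = Set.univ := by ext x; simp
    rw [this, Measure.restrict_univ]
  · intro i j hij
    exact Disjoint.preimage _ (by simpa using hij)

lemma wf_carleson_step {X I : Type*} [MeasurableSpace X] (ν : Measure X) [Countable I]
    [MeasurableSpace I] [DiscreteMeasurableSpace I] (φ : X → I) (hφ : Measurable φ)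
    (F G δ : X → ℝ≥0∞) (hF : Measurable F) (hG : Measurable G) (hδ : ∀ x y, φ x = φ y → δ x = δ y) (c : ℝ≥0∞)
    (h : ∀ i, ∫⁻ x in φ ⁻¹' {i}, F x ∂ν ≤ c * ∫⁻ x in φ ⁻¹' {i}, G x ∂ν) :
    ∫⁻ x, F x * δ x ∂ν ≤ c * ∫⁻ x, G x * δ x ∂ν := by
  rw [wf_lint_fiber ν φ hφ, wf_lint_fiber ν φ hφ (fun x => G x * δ x), ← ENNReal.tsum_mul_left]
  refine ENNReal.tsum_le_tsum fun i => ?_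
  by_cases hi : ∃ y, φ y = i
  · obtain ⟨y, rfl⟩ := hi
    have aux : ∀ H : X → ℝ≥0∞, Measurable H → ∫⁻ x in φ ⁻¹' {φ y}, H x * δ x ∂ν = (∫⁻ x in φ ⁻¹' {φ y}, H x ∂ν) * δ y := by
      intro H hH
      rw [← lintegral_mul_const _ hH]
      refine setLIntegral_congr_fun (hφ (measurableSet_singleton _)) fun x hx => ?_
      rw [hδ x y hx]
    rw [aux F hF, aux G hG, ← mul_assoc]
    gcongr
    exact h _
  · have : φ ⁻¹' {i} = ∅ := by
      ext x; simp only [Set.mem_preimage, Set.mem_singleton_iff, Set.mem_empty_iff_false, iff_false]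
      exact fun hx => hi ⟨x, hx⟩
    simp [this]

lemma wf_meas_fac {X I : Type*} [MeasurableSpace X] [Countable I]
    [MeasurableSpace I] [DiscreteMeasurableSpace I] (φ : X → I) (hφ : Measurable φ)
    (δ : X → ℝ≥0∞) (hδ : ∀ x y, φ x = φ y → δ x = δ y) : Measurable δ := by
  have : ∃ g : I → ℝ≥0∞, δ = g ∘ φ := (Function.factorsThrough_iff δ).1 (fun x y h => hδ x y h)
  obtain ⟨g, rfl⟩ := this
  exact (measurable_of_countable g).comp hφ

/-- finite version -/
lemma wf_abs_fin {X I : Type*} [MeasurableSpace X] (ν : Measure X) [Countable I]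
    [MeasurableSpace I] [DiscreteMeasurableSpace I] (φ : ℕ → X → I) (hφ : ∀ n, Measurable (φ n))
    (href : ∀ k n, k ≤ n → ∀ x y, φ n x = φ n y → φ k x = φ k y)
    (a : ℕ → X → ℝ≥0∞) (ha : ∀ n x y, φ n x = φ n y → a n x = a n y)
    (c : ℕ → ℝ≥0∞)
    (hc : ∀ k j i, ∫⁻ x in φ k ⁻¹' {i}, a (k + j) x ∂ν ≤ c j * ∫⁻ x in φ k ⁻¹' {i}, a k x ∂ν)
    (hc0 : ∑' j, c j ≠ 0) {q : ℝ} (hq : 1 ≤ q) (m : ℕ) :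
    ∫⁻ x, (∑ n ∈ Finset.range m, a n x) ^ q ∂ν ≤
      ((∑' j, c j) * ENNReal.ofReal q) ^ q * ∫⁻ x, (⨆ n, a n x) ^ q ∂ν := by
  have hq0 : 0 < q := by linarith
  set C := ∑' j, c j with hC
  set S : ℕ → X → ℝ≥0∞ := fun k x => ∑ n ∈ Finset.range k, a n x with hS
  set M : X → ℝ≥0∞ := fun x => ⨆ n, a n x with hM
  have am : ∀ n, Measurable (a n) := fun n => wf_meas_fac (φ n) (hφ n) _ (ha n)
  have Mm : Measurable M := Measurable.iSup am
  have Sm : ∀ k, Measurable (S k) := fun k => Finset.measurable_sum _ (fun n _ => am n)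
  have Ssucc : ∀ k x, S (k + 1) x = S k x + a k x := fun k x => Finset.sum_range_succ _ _
  have Smono : ∀ k x, S k x ≤ S (k + 1) x := fun k x => by rw [Ssucc]; exact le_self_add
  have Sfac : ∀ k l x y, k ≤ l + 1 → φ l x = φ l y → S k x = S k y := by
    intro k l x y hkl h
    refine Finset.sum_congr rfl fun n hn => ha n x y (href n l ?_ x y h)
    have := Finset.mem_range.1 hn
    omega
  set Y := ∫⁻ x, M x ^ q ∂ν with hY
  set Z := ∫⁻ x, S m x ^ q ∂ν with hZ
  by_cases hYt : Y = ∞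
  · have : (C * ENNReal.ofReal q) ^ q ≠ 0 := by
      simp [ENNReal.rpow_eq_zero_iff, hc0, hq0, not_lt.2 hq0.le]
    rw [hYt, ENNReal.mul_top this]; exact le_top
  have hZt : Z ≠ ∞ := by
    have : Z ≤ (m : ℝ≥0∞) ^ q * Y := by
      rw [hY, ← lintegral_const_mul _ (Mm.pow_const q)]
      refine lintegral_mono fun x => ?_
      rw [← ENNReal.mul_rpow_of_nonneg _ _ hq0.le]
      refine ENNReal.rpow_le_rpow ?_ hq0.le
      calc S m x ≤ ∑ n ∈ Finset.range m, M x := Finset.sum_le_sum fun n _ => le_iSup (fun n => a n x) n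
        _ = m * M x := by simp
    refine ne_top_of_le_ne_top ?_ this
    exact ENNReal.mul_ne_top (ENNReal.rpow_ne_top_of_nonneg hq0.le (by simp)) hYt
  -- increments
  set δ : ℕ → X → ℝ≥0∞ := fun k x => if k = 0 then S 1 x ^ (q - 1) else S (k + 1) x ^ (q - 1) - S k x ^ (q - 1) with hδ
  have δfac : ∀ k x y, φ k x = φ k y → δ k x = δ k y := by
    intro k x y h
    simp only [hδ]
    split_ifs with h0
    · rw [Sfac 1 k x y (by omega) h]
    · rw [Sfac (k+1) k x y le_rfl h, Sfac k k x y (by omega) h]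
  have δm : ∀ k, Measurable (δ k) := fun k => wf_meas_fac (φ k) (hφ k) _ (δfac k)
  have δsum : ∀ n x, ∑ k ∈ Finset.range (n + 1), δ k x = S (n + 1) x ^ (q - 1) := by
    intro n x
    induction n with
    | zero => simp [hδ]
    | succ n ih =>
      rw [Finset.sum_range_succ, ih]
      simp only [hδ, Nat.succ_ne_zero, if_false]
      exact add_tsub_cancel_of_le (ENNReal.rpow_le_rpow (Smono _ x) (by linarith))
  have pt : ∀ k x, S k x ^ q ≤ ENNReal.ofReal q * ∑ n ∈ Finset.range k, a n x * S (n + 1) x ^ (q - 1) := by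
    intro k x
    induction k with
    | zero => simp [hS, hq0]
    | succ k ih =>
      rw [Finset.sum_range_succ, mul_add]
      refine le_trans ?_ (add_le_add_left ih _)
      rw [Ssucc]
      exact wf_convex _ _ hq
  have step : ∀ k j, ∫⁻ x, a (k + j) x * δ k x ∂ν ≤ c j * ∫⁻ x, a k x * δ k x ∂ν := fun k j =>
    wf_carleson_step ν (φ k) (hφ k) _ _ _ (am _) (am _) (δfac k) _ (hc k j)
  have mS : ∀ n, Measurable (fun x => a n x * S (n + 1) x ^ (q - 1)) := fun n =>
    (am n).mul ((Sm _).pow_const _)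
  have md : ∀ n k, Measurable (fun x => a n x * δ k x) := fun n k => (am n).mul (δm k)
  have main : Z ≤ ENNReal.ofReal q * (C * ∫⁻ x, M x * S m x ^ (q - 1) ∂ν) := by
    rcases m with _ | m
    · have : Z = 0 := by simp [hZ, hS, hq0]
      rw [this]; exact zero_le
    calc Z ≤ ∫⁻ x, ENNReal.ofReal q * ∑ n ∈ Finset.range (m+1), a n x * S (n + 1) x ^ (q - 1) ∂ν :=
          lintegral_mono fun x => pt _ x
      _ = ENNReal.ofReal q * ∑ n ∈ Finset.range (m+1), ∫⁻ x, a n x * S (n + 1) x ^ (q - 1) ∂ν := by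
          rw [lintegral_const_mul _ (Finset.measurable_sum _ fun n _ => mS n),
            lintegral_finsetSum _ fun n _ => mS n]
      _ = ENNReal.ofReal q * ∑ n ∈ Finset.range (m+1), ∑ k ∈ Finset.range (n + 1), ∫⁻ x, a n x * δ k x ∂ν := by
          congr 1
          refine Finset.sum_congr rfl fun n _ => ?_
          rw [← lintegral_finsetSum _ fun k _ => md n k]
          simp_rw [← Finset.mul_sum, δsum]
      _ ≤ ENNReal.ofReal q * ∑ n ∈ Finset.range (m+1), ∑ k ∈ Finset.range (n + 1), c (n - k) * ∫⁻ x, a k x * δ k x ∂ν := by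
          gcongr with n hn k hk
          have := step k (n - k)
          have hk := Finset.mem_range.1 hk
          rwa [show k + (n - k) = n by omega] at this
      _ = ENNReal.ofReal q * ∑ k ∈ Finset.range (m+1), ∑ n ∈ Finset.Ico k (m+1), c (n - k) * ∫⁻ x, a k x * δ k x ∂ν := by
          congr 1
          refine Finset.sum_comm' fun n k => ?_
          simp only [Finset.mem_range, Finset.mem_Ico]; omega
      _ ≤ ENNReal.ofReal q * ∑ k ∈ Finset.range (m+1), C * ∫⁻ x, a k x * δ k x ∂ν := by
          gcongr with k hk
          rw [← Finset.sum_mul]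
          gcongr
          rw [Finset.sum_Ico_eq_sum_range]
          simp only [add_tsub_cancel_left]
          exact ENNReal.sum_le_tsum _
      _ = ENNReal.ofReal q * (C * ∫⁻ x, ∑ k ∈ Finset.range (m+1), a k x * δ k x ∂ν) := by
          rw [← Finset.mul_sum, lintegral_finsetSum _ fun k _ => md k k]
      _ ≤ _ := by
          gcongr with x
          rw [← δsum, Finset.mul_sum]
          gcongr with k hk
          exact le_iSup (fun n => a n x) k
  have hol : ∫⁻ x, M x * S m x ^ (q - 1) ∂ν ≤ Y ^ (1/q) * Z ^ (1 - 1/q) := by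
    have h1q : 1 / q ≤ 1 := by rw [div_le_one hq0]; exact hq
    have := ENNReal.lintegral_mul_norm_pow_le (μ := ν) (f := fun x => M x ^ q) (g := fun x => S m x ^ q)
      (Mm.pow_const q).aemeasurable ((Sm m).pow_const q).aemeasurable
      (p := 1/q) (q := 1 - 1/q) (by positivity) (by linarith) (by ring)
    refine le_trans (le_of_eq ?_) this
    refine lintegral_congr fun x => ?_
    rw [← ENNReal.rpow_mul, ← ENNReal.rpow_mul]
    congr 2
    · rw [mul_one_div_cancel hq0.ne', ENNReal.rpow_one]
    · field_simp
  by_cases hZ0 : Z = 0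
  · rw [hZ0]; exact zero_le
  have h1 : Z ^ (1/q) * Z ^ (1 - 1/q) ≤ (C * ENNReal.ofReal q * Y ^ (1/q)) * Z ^ (1 - 1/q) := by
    rw [← ENNReal.rpow_add _ _ hZ0 hZt]
    rw [show 1/q + (1 - 1/q) = 1 by ring, ENNReal.rpow_one]
    refine main.trans ?_
    calc _ ≤ ENNReal.ofReal q * (C * (Y ^ (1/q) * Z ^ (1 - 1/q))) := by gcongr
      _ = _ := by ring
  have h2 : Z ^ (1/q) ≤ C * ENNReal.ofReal q * Y ^ (1/q) := by
    have n0 : Z ^ (1 - 1/q) ≠ 0 := by simp [ENNReal.rpow_eq_zero_iff, hZ0, hZt]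
    have nt : Z ^ (1 - 1/q) ≠ ∞ := by simp [ENNReal.rpow_eq_top_iff, hZ0, hZt]
    exact (ENNReal.mul_le_mul_iff_left n0 nt).1 h1
  have h3 := ENNReal.rpow_le_rpow h2 hq0.le
  rw [ENNReal.mul_rpow_of_nonneg _ _ hq0.le, ← ENNReal.rpow_mul, ← ENNReal.rpow_mul,
    one_div_mul_cancel hq0.ne', ENNReal.rpow_one, ENNReal.rpow_one] at h3
  exact h3

lemma wf_iSup_rpow {ι : Type*} (f : ι → ℝ≥0∞) {q : ℝ} (hq : 0 < q) :
    (⨆ i, f i) ^ q = ⨆ i, f i ^ q := (ENNReal.orderIsoRpow q hq).map_iSup f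

lemma wf_abs {X I : Type*} [MeasurableSpace X] (ν : Measure X) [Countable I]
    [MeasurableSpace I] [DiscreteMeasurableSpace I] (φ : ℕ → X → I) (hφ : ∀ n, Measurable (φ n))
    (href : ∀ k n, k ≤ n → ∀ x y, φ n x = φ n y → φ k x = φ k y)
    (a : ℕ → X → ℝ≥0∞) (ha : ∀ n x y, φ n x = φ n y → a n x = a n y)
    (c : ℕ → ℝ≥0∞)
    (hc : ∀ k j i, ∫⁻ x in φ k ⁻¹' {i}, a (k + j) x ∂ν ≤ c j * ∫⁻ x in φ k ⁻¹' {i}, a k x ∂ν)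
    (hc0 : ∑' j, c j ≠ 0) {q : ℝ} (hq : 1 ≤ q) :
    ∫⁻ x, (∑' n, a n x) ^ q ∂ν ≤
      ((∑' j, c j) * ENNReal.ofReal q) ^ q * ∫⁻ x, (⨆ n, a n x) ^ q ∂ν := by
  have hq0 : 0 < q := by linarith
  have am : ∀ n, Measurable (a n) := fun n => wf_meas_fac (φ n) (hφ n) _ (ha n)
  have e : ∀ x, (∑' n, a n x) ^ q = ⨆ m : ℕ, (∑ n ∈ Finset.range m, a n x) ^ q := by
    intro x
    rw [ENNReal.tsum_eq_iSup_nat, wf_iSup_rpow _ hq0]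
  simp_rw [e]
  rw [lintegral_iSup (fun m => (Finset.measurable_sum _ (fun n _ => am n)).pow_const q)]
  · exact iSup_le fun m => wf_abs_fin ν φ hφ href a ha c hc hc0 hq m
  · intro i j hij x
    refine ENNReal.rpow_le_rpow ?_ hq0.le
    exact Finset.sum_le_sum_of_subset (by simpa using hij)

noncomputable def wfPhi (N : ℕ) (l : ℝ) (x : EuclideanSpace ℝ (Fin N)) : Fin N → ℤ :=
  fun i => ⌊x i / l⌋

def wfT (N : ℕ) (l : ℝ) (m : Fin N → ℤ) : Set (EuclideanSpace ℝ (Fin N)) :=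
  {y | ∀ i, |wfPhi N l y i - m i| ≤ 1}

lemma wfPhi_meas (N : ℕ) (l : ℝ) : Measurable (wfPhi N l) := by
  refine measurable_pi_lambda _ fun i => ?_
  have : Measurable (fun x : EuclideanSpace ℝ (Fin N) => x i / l) := by fun_prop
  exact Int.measurable_floor.comp this

lemma wfT_meas (N : ℕ) (l : ℝ) (m) : MeasurableSet (wfT N l m) := by
  have : wfT N l m = wfPhi N l ⁻¹' {k | ∀ i, |k i - m i| ≤ 1} := rfl
  rw [this]
  exact wfPhi_meas N l (Set.to_countable _).measurableSet

lemma wf_ball_sub (N : ℕ) {l t : ℝ} (hl : 0 < l) (ht : t ≤ l) (x : EuclideanSpace ℝ (Fin N)) :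
    Metric.ball x t ⊆ wfT N l (wfPhi N l x) := by
  intro y hy i
  have h1 : |y i - x i| < l := by
    have := PiLp.norm_apply_le (y - x) i
    rw [Metric.mem_ball, dist_eq_norm] at hy
    simp only [PiLp.sub_apply, Real.norm_eq_abs] at this
    linarith
  have h2 : |y i / l - x i / l| < 1 := by
    rw [← sub_div, abs_div, abs_of_pos hl, div_lt_one hl]; exact h1
  simp only [wfPhi]
  rw [abs_lt] at h2
  have a1 := Int.floor_le (y i / l)
  have a2 := Int.lt_floor_add_one (y i / l)
  have b1 := Int.floor_le (x i / l)
  have b2 := Int.lt_floor_add_one (x i / l)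
  rw [abs_le]
  constructor
  · have : ((⌊x i / l⌋ : ℤ) : ℝ) < ⌊y i / l⌋ + 2 := by linarith
    have : ⌊x i / l⌋ < ⌊y i / l⌋ + 2 := by exact_mod_cast this
    omega
  · have : ((⌊y i / l⌋ : ℤ) : ℝ) < ⌊x i / l⌋ + 2 := by linarith
    have : ⌊y i / l⌋ < ⌊x i / l⌋ + 2 := by exact_mod_cast this
    omega

lemma wf_sub_ball (N : ℕ) (hN : 0 < N) {l : ℝ} (hl : 0 < l) (x : EuclideanSpace ℝ (Fin N)) :
    wfT N l (wfPhi N l x) ⊆ Metric.ball x (4 * N * l) := by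
  intro y hy
  have hN1 : (1:ℝ) ≤ N := by exact_mod_cast hN
  have hc : ∀ i, |(y - x) i| ≤ 2 * l := by
    intro i
    have h := hy i
    simp only [wfPhi] at h
    rw [abs_le] at h
    have a1 := Int.floor_le (y i / l)
    have a2 := Int.lt_floor_add_one (y i / l)
    have b1 := Int.floor_le (x i / l)
    have b2 := Int.lt_floor_add_one (x i / l)
    have h1 : (-1 : ℝ) ≤ (⌊y i / l⌋ : ℝ) - ⌊x i / l⌋ := by exact_mod_cast h.1
    have h2 : (⌊y i / l⌋ : ℝ) - ⌊x i / l⌋ ≤ 1 := by exact_mod_cast h.2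
    have h3 : |y i / l - x i / l| ≤ 2 := by rw [abs_le]; constructor <;> linarith
    rw [← sub_div, abs_div, abs_of_pos hl, div_le_iff₀ hl] at h3
    simpa using h3
  rw [Metric.mem_ball, dist_eq_norm]
  have h4 : ‖y - x‖ ≤ 2 * l * N := by
    rw [EuclideanSpace.norm_eq]
    apply Real.sqrt_le_iff.2
    refine ⟨by positivity, ?_⟩
    calc ∑ i, ‖(y - x) i‖ ^ 2 ≤ ∑ i : Fin N, (2 * l) ^ 2 := by
          refine Finset.sum_le_sum fun i _ => ?_
          have := hc i
          rw [Real.norm_eq_abs]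
          gcongr
      _ = N * (2 * l) ^ 2 := by simp
      _ ≤ (2 * l * N) ^ 2 := by
          have : (N:ℝ) ≤ N ^ 2 := by nlinarith
          have : (N:ℝ) * (2*l)^2 ≤ N ^ 2 * (2*l)^2 := by gcongr
          linarith
  have : 0 < l * N := by positivity
  linarith

lemma wf_vol (N : ℕ) {l : ℝ} (hl : 0 < l) (m : Fin N → ℤ) :
    volume (wfPhi N l ⁻¹' {m}) = ENNReal.ofReal (l ^ N) := by
  have e : wfPhi N l ⁻¹' {m} = (@WithLp.ofLp 2 (Fin N → ℝ)) ⁻¹'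
      (Set.pi Set.univ fun i => Set.Ico (m i * l : ℝ) ((m i + 1) * l)) := by
    ext x
    simp only [Set.mem_preimage, Set.mem_singleton_iff, Set.mem_pi, Set.mem_univ, true_imp_iff, Set.mem_Ico]
    rw [funext_iff]
    refine forall_congr' fun i => ?_
    simp only [wfPhi]
    rw [Int.floor_eq_iff, le_div_iff₀ hl, div_lt_iff₀ hl]
  rw [e, (PiLp.volume_preserving_ofLp (Fin N)).measure_preimage]
  · rw [Real.volume_pi_Ico]
    have : ∀ i, ((m i + 1) * l : ℝ) - m i * l = l := fun i => by ring
    simp_rw [this]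
    simp [ENNReal.ofReal_pow hl.le]
  · exact (MeasurableSet.univ_pi fun i => measurableSet_Ico).nullMeasurableSet

lemma wf_refine (N : ℕ) {l : ℝ} (j : ℕ) (x : EuclideanSpace ℝ (Fin N)) (i : Fin N) :
    wfPhi N l x i = wfPhi N (l / 2 ^ j) x i / (2 ^ j : ℤ) := by
  simp only [wfPhi]
  have := Int.floor_div_natCast (x i / (l / 2 ^ j)) (2 ^ j)
  push_cast at this
  rw [← this]
  congr 1
  have : (2:ℝ) ^ j ≠ 0 := by positivity
  field_simp

lemma wf_div_near (a b : ℤ) (n : ℤ) (hn : 0 < n) (h : |a - b| ≤ 1) : |a / n - b / n| ≤ 1 := by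
  rw [abs_le] at *
  have h1 : a / n ≤ (b + n) / n := Int.ediv_le_ediv hn (by omega)
  have h2 : b / n ≤ (a + n) / n := Int.ediv_le_ediv hn (by omega)
  rw [Int.add_ediv_of_dvd_right (dvd_refl n), Int.ediv_self hn.ne'] at h1 h2
  constructor <;> omega

lemma wf_base (N : ℕ) {l : ℝ} (hl : 0 < l) (j : ℕ) (μ : Measure (EuclideanSpace ℝ (Fin N)))
    (m : Fin N → ℤ) :
    ∫⁻ x in wfPhi N l ⁻¹' {m}, μ (wfT N (l / 2 ^ j) (wfPhi N (l / 2 ^ j) x)) ≤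
      3 ^ N * (ENNReal.ofReal ((l / 2 ^ j) ^ N) * μ (wfT N l m)) := by
  set l' := l / 2 ^ j with hl'
  have hl0 : 0 < l' := by positivity
  set F : Finset (Fin N → ℤ) := Fintype.piFinset fun _ => Finset.Icc (-1) 1 with hF
  have hFc : F.card = 3 ^ N := by simp [hF, Fintype.card_piFinset]
  have hφ := wfPhi_meas N l'
  have hcov : ∀ i, μ (wfT N l' i) ≤ ∑ e ∈ F, μ (wfPhi N l' ⁻¹' {i + e}) := by
    intro i
    refine (measure_mono ?_).trans (measure_biUnion_finset_le F _)
    intro y hy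
    simp only [Set.mem_iUnion]
    refine ⟨wfPhi N l' y - i, ?_, by simp⟩
    rw [hF, Fintype.mem_piFinset]
    intro k
    have := abs_le.1 (hy k)
    simpa using this
  rw [wf_lint_fiber _ (wfPhi N l') hφ]
  have hterm : ∀ i, ∫⁻ x in wfPhi N l' ⁻¹' {i}, μ (wfT N l' (wfPhi N l' x)) ∂(volume.restrict (wfPhi N l ⁻¹' {m}))
      ≤ ∑ e ∈ F, ENNReal.ofReal (l' ^ N) * μ (wfPhi N l' ⁻¹' {i + e} ∩ wfT N l m) := by
    intro i
    have e1 : ∫⁻ x in wfPhi N l' ⁻¹' {i}, μ (wfT N l' (wfPhi N l' x)) ∂(volume.restrict (wfPhi N l ⁻¹' {m}))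
      = μ (wfT N l' i) * volume (wfPhi N l' ⁻¹' {i} ∩ wfPhi N l ⁻¹' {m}) := by
      rw [← Measure.restrict_apply (hφ (measurableSet_singleton i)), ← setLIntegral_const]
      refine setLIntegral_congr_fun (hφ (measurableSet_singleton _)) fun x hx => ?_
      rw [show wfPhi N l' x = i from hx]
    rw [e1]
    by_cases hne : (wfPhi N l' ⁻¹' {i} ∩ wfPhi N l ⁻¹' {m}).Nonempty
    · obtain ⟨x, hx1, hx2⟩ := hne
      have hx1 : wfPhi N l' x = i := hx1
      have hx2 : wfPhi N l x = m := hx2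
      have hv : volume (wfPhi N l' ⁻¹' {i} ∩ wfPhi N l ⁻¹' {m}) ≤ ENNReal.ofReal (l' ^ N) := by
        rw [← wf_vol N hl0 i]; exact measure_mono Set.inter_subset_left
      calc _ ≤ (∑ e ∈ F, μ (wfPhi N l' ⁻¹' {i + e})) * ENNReal.ofReal (l' ^ N) :=
            mul_le_mul' (hcov i) hv
        _ = ∑ e ∈ F, ENNReal.ofReal (l' ^ N) * μ (wfPhi N l' ⁻¹' {i + e}) := by
            rw [mul_comm, Finset.mul_sum]
        _ ≤ _ := by
            refine Finset.sum_le_sum fun e he => ?_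
            gcongr
            refine Set.subset_inter le_rfl ?_
            intro y hy k
            have hy : wfPhi N l' y = i + e := hy
            rw [← hx2, wf_refine N j y k, wf_refine N j x k, ← hl', hy, hx1]
            apply wf_div_near _ _ _ (by positivity)
            rw [hF, Fintype.mem_piFinset] at he
            have := Finset.mem_Icc.1 (he k)
            rw [abs_le]; simp only [Pi.add_apply]; omega
    · rw [Set.not_nonempty_iff_eq_empty] at hne
      simp [hne]
  refine (ENNReal.tsum_le_tsum hterm).trans ?_
  rw [Summable.tsum_finsetSum fun _ _ => ENNReal.summable]
  have hs : ∀ e ∈ F, ∑' i, ENNReal.ofReal (l' ^ N) * μ (wfPhi N l' ⁻¹' {i + e} ∩ wfT N l m) ≤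
      ENNReal.ofReal (l' ^ N) * μ (wfT N l m) := by
    intro e _
    rw [ENNReal.tsum_mul_left]
    gcongr
    refine (tsum_meas_le_meas_iUnion_of_disjoint μ (fun i => (hφ (measurableSet_singleton _)).inter (wfT_meas N l m)) ?_).trans
      (measure_mono (Set.iUnion_subset fun i => Set.inter_subset_right))
    intro a b hab
    refine Disjoint.mono Set.inter_subset_left Set.inter_subset_left ?_
    exact Disjoint.preimage _ (by simpa using hab)
  refine (Finset.sum_le_sum hs).trans ?_
  rw [Finset.sum_const, hFc, nsmul_eq_mul]
  push_cast
  exact le_rfl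

noncomputable def wfB (N : ℕ) (d : ℝ) (μ : Measure (EuclideanSpace ℝ (Fin N))) (l : ℝ)
    (x : EuclideanSpace ℝ (Fin N)) : ℝ≥0∞ :=
  μ (wfT N l (wfPhi N l x)) / ENNReal.ofReal (l ^ d)

lemma wfB_fac (N : ℕ) (d : ℝ) (μ : Measure (EuclideanSpace ℝ (Fin N))) (l : ℝ) (x y)
    (h : wfPhi N l x = wfPhi N l y) : wfB N d μ l x = wfB N d μ l y := by
  simp only [wfB, h]

lemma wfB_meas (N : ℕ) (d : ℝ) (μ : Measure (EuclideanSpace ℝ (Fin N))) (l : ℝ) :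
    Measurable (wfB N d μ l) := wf_meas_fac _ (wfPhi_meas N l) _ (wfB_fac N d μ l)

lemma wf_carl1 (N : ℕ) (d : ℝ) {l : ℝ} (hl : 0 < l) (j : ℕ) (μ : Measure (EuclideanSpace ℝ (Fin N)))
    (m : Fin N → ℤ) :
    ∫⁻ x in wfPhi N l ⁻¹' {m}, wfB N d μ (l / 2 ^ j) x ≤
      3 ^ N * ENNReal.ofReal (2 ^ (-(N - d))) ^ j * ((μ (wfT N l m) / ENNReal.ofReal (l ^ d)) * volume (wfPhi N l ⁻¹' {m})) := by
  have hl0 : 0 < l / 2 ^ j := by positivity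
  simp only [wfB, ENNReal.div_eq_inv_mul]
  rw [lintegral_const_mul' _ _ (by simp; positivity)]
  rw [wf_vol N hl]
  calc _ ≤ (ENNReal.ofReal ((l / 2 ^ j) ^ d))⁻¹ * (3 ^ N * (ENNReal.ofReal ((l / 2 ^ j) ^ N) * μ (wfT N l m))) := by
        gcongr; exact wf_base N hl j μ m
    _ = 3 ^ N * μ (wfT N l m) * ((ENNReal.ofReal ((l / 2 ^ j) ^ d))⁻¹ * ENNReal.ofReal ((l / 2 ^ j) ^ N)) := by ring
    _ = 3 ^ N * μ (wfT N l m) * (ENNReal.ofReal (2 ^ (-(N - d))) ^ j * ((ENNReal.ofReal (l ^ d))⁻¹ * ENNReal.ofReal (l ^ N))) := by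
        congr 1
        rw [← ENNReal.ofReal_inv_of_pos (by positivity), ← ENNReal.ofReal_inv_of_pos (by positivity),
          ← ENNReal.ofReal_pow (by positivity), ← ENNReal.ofReal_mul (by positivity), ← ENNReal.ofReal_mul (by positivity),
          ← ENNReal.ofReal_mul (by positivity)]
        congr 1
        rw [Real.div_rpow hl.le (by positivity), Real.rpow_neg (by norm_num), Real.rpow_sub (by norm_num), Real.rpow_natCast,
          ← Real.rpow_natCast 2 j, ← Real.rpow_mul (by norm_num), mul_comm (j:ℝ) d, Real.rpow_mul (by norm_num), Real.rpow_natCast,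
          Real.rpow_natCast, div_pow]
        have h1 : (0:ℝ) < 2 ^ d := by positivity
        have h2 : (0:ℝ) < l ^ d := by positivity
        rw [inv_pow, div_pow, ← pow_mul, ← pow_mul, mul_comm N j]
        field_simp
    _ = _ := by ring

lemma wf_carls (N : ℕ) (d : ℝ) {s : ℝ} (hs : 0 < s) (hs1 : s ≤ 1) {l : ℝ} (hl : 0 < l) (j : ℕ) (μ : Measure (EuclideanSpace ℝ (Fin N)))
    (m : Fin N → ℤ) :
    ∫⁻ x in wfPhi N l ⁻¹' {m}, wfB N d μ (l / 2 ^ j) x ^ s ≤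
      (3 ^ N * ENNReal.ofReal (2 ^ (-(N - d))) ^ j) ^ s * ∫⁻ x in wfPhi N l ⁻¹' {m}, wfB N d μ l x ^ s := by
  have e : ∫⁻ x in wfPhi N l ⁻¹' {m}, wfB N d μ l x ^ s =
      (μ (wfT N l m) / ENNReal.ofReal (l ^ d)) ^ s * volume (wfPhi N l ⁻¹' {m}) := by
    rw [← setLIntegral_const]
    refine setLIntegral_congr_fun (wfPhi_meas N l (measurableSet_singleton _)) fun x hx => ?_
    simp only [wfB]
    rw [show wfPhi N l x = m from hx]
  rw [e]
  have h := ENNReal.lintegral_mul_norm_pow_le (μ := volume.restrict (wfPhi N l ⁻¹' {m}))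
    (f := wfB N d μ (l / 2 ^ j)) (g := fun _ => 1) (wfB_meas _ _ _ _).aemeasurable aemeasurable_const
    (p := s) (q := 1 - s) hs.le (by linarith) (by ring)
  simp only [ENNReal.one_rpow, mul_one, lintegral_one, Measure.restrict_apply_univ] at h
  refine h.trans ?_
  have hV0 : volume (wfPhi N l ⁻¹' {m}) ≠ 0 := by
    rw [wf_vol N hl]; simp; positivity
  have hVt : volume (wfPhi N l ⁻¹' {m}) ≠ ∞ := by
    rw [wf_vol N hl]; simp
  have h1 := wf_carl1 N d hl j μ m
  set V := volume (wfPhi N l ⁻¹' {m})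
  calc _ ≤ (3 ^ N * ENNReal.ofReal (2 ^ (-(N - d))) ^ j * ((μ (wfT N l m) / ENNReal.ofReal (l ^ d)) * V)) ^ s * V ^ (1 - s) := by
        gcongr
    _ = (3 ^ N * ENNReal.ofReal (2 ^ (-(N - d))) ^ j) ^ s * ((μ (wfT N l m) / ENNReal.ofReal (l ^ d)) ^ s * (V ^ s * V ^ (1 - s))) := by
        rw [ENNReal.mul_rpow_of_nonneg _ _ hs.le, ENNReal.mul_rpow_of_nonneg (_ / _) _ hs.le]
        ring
    _ = _ := by
        rw [← ENNReal.rpow_add _ _ hV0 hVt, show s + (1 - s) = 1 by ring, ENNReal.rpow_one]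

lemma wf_disc1 (N : ℕ) (d : ℝ) (hd : d < N) {s : ℝ} (hs : 0 < s) (hs1 : s ≤ 1) :
    ∃ C : ℝ≥0∞, C ≠ ∞ ∧ ∀ (L : ℝ), 0 < L → ∀ (μ : Measure (EuclideanSpace ℝ (Fin N))) (q : ℝ),
      0 < q → 1 ≤ s * q →
      ∫⁻ x, (∑' n : ℕ, wfB N d μ (L / 2 ^ n) x ^ s) ^ q ≤
        (C * ENNReal.ofReal q) ^ q * ∫⁻ x, (⨆ n : ℕ, wfB N d μ (L / 2 ^ n) x) ^ (s * q) := by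
  set ρ : ℝ≥0∞ := ENNReal.ofReal (2 ^ (-(N - d))) with hρ
  have hρ1 : ρ < 1 := by
    rw [hρ, ENNReal.ofReal_lt_one]
    exact Real.rpow_lt_one_of_one_lt_of_neg (by norm_num) (by linarith)
  set c : ℕ → ℝ≥0∞ := fun j => (3 ^ N * ρ ^ j) ^ s with hc
  have hce : ∀ j, c j = (3 ^ N) ^ s * (ρ ^ s) ^ j := by
    intro j
    simp only [hc]
    rw [ENNReal.mul_rpow_of_nonneg _ _ hs.le, ← ENNReal.rpow_natCast ρ, ← ENNReal.rpow_natCast (ρ ^ s),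
      ← ENNReal.rpow_mul, ← ENNReal.rpow_mul, mul_comm s]
  refine ⟨∑' j, c j, ?_, ?_⟩
  · simp_rw [hce]
    rw [ENNReal.tsum_mul_left, ENNReal.tsum_geometric]
    refine ENNReal.mul_ne_top (ENNReal.rpow_ne_top_of_nonneg hs.le (by simp)) ?_
    rw [ENNReal.inv_ne_top]
    have : ρ ^ s < 1 := ENNReal.rpow_lt_one hρ1 hs
    exact (tsub_pos_of_lt this).ne'
  · intro L hL μ q hq hsq
    have hq1 : 1 ≤ q := by nlinarith
    have hc0 : ∑' j, c j ≠ 0 := by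
      have h0 : c 0 ≠ 0 := by
        simp [hc, ENNReal.rpow_eq_zero_iff, hs, hs.le]
      intro h
      exact h0 (ENNReal.tsum_eq_zero.1 h 0)
    have := wf_abs volume (fun n => wfPhi N (L / 2 ^ n)) (fun n => wfPhi_meas N _)
      (fun k n hkn x y h => by
        funext i
        obtain ⟨j, rfl⟩ := Nat.exists_eq_add_of_le hkn
        rw [wf_refine N j x i, wf_refine N j y i]
        have e : L / 2 ^ k / 2 ^ j = L / 2 ^ (k + j) := by rw [pow_add, div_div]
        rw [e]
        rw [show wfPhi N (L / 2 ^ (k + j)) x = wfPhi N (L / 2 ^ (k + j)) y from h])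
      (fun n x => wfB N d μ (L / 2 ^ n) x ^ s)
      (fun n x y h => by
        rw [wfB_fac N d μ _ x y h])
      c
      (fun k j i => by
        have := wf_carls N d hs hs1 (l := L / 2 ^ k) (by positivity) j μ i
        rw [show L / 2 ^ k / 2 ^ j = L / 2 ^ (k + j) by rw [pow_add, div_div]] at this
        exact this)
      hc0 hq1
    refine this.trans (le_of_eq ?_)
    congr 1
    refine lintegral_congr fun x => ?_
    rw [← wf_iSup_rpow _ hs, ← ENNReal.rpow_mul]

lemma wf_disc (N : ℕ) (d : ℝ) (hd : d < N) {s : ℝ} (hs : 0 < s) :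
    ∃ C : ℝ≥0∞, C ≠ ∞ ∧ ∀ (L : ℝ), 0 < L → ∀ (μ : Measure (EuclideanSpace ℝ (Fin N))) (q : ℝ),
      0 < q → 1 ≤ s * q →
      ∫⁻ x, (∑' n : ℕ, wfB N d μ (L / 2 ^ n) x ^ s) ^ q ≤
        (C * ENNReal.ofReal q) ^ q * ∫⁻ x, (⨆ n : ℕ, wfB N d μ (L / 2 ^ n) x) ^ (s * q) := by
  rcases le_total s 1 with hs1 | hs1
  · exact wf_disc1 N d hd hs hs1
  obtain ⟨C, hC, h⟩ := wf_disc1 N d hd (s := 1) one_pos le_rfl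
  refine ⟨C * ENNReal.ofReal s, ENNReal.mul_ne_top hC (by simp), ?_⟩
  intro L hL μ q hq hsq
  have hsq0 : 0 < s * q := by positivity
  have h' := h L hL μ (s * q) hsq0 (by linarith)
  simp only [ENNReal.rpow_one, one_mul] at h'
  set B : EuclideanSpace ℝ (Fin N) → ℝ≥0∞ := fun x => ⨆ n : ℕ, wfB N d μ (L / 2 ^ n) x with hB
  set S : EuclideanSpace ℝ (Fin N) → ℝ≥0∞ := fun x => ∑' n : ℕ, wfB N d μ (L / 2 ^ n) x with hS
  have Bm : Measurable B := Measurable.iSup fun n => wfB_meas _ _ _ _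
  have Sm : Measurable S := Measurable.ennreal_tsum fun n => wfB_meas _ _ _ _
  have h1s : 1 / s ≤ 1 := by rw [div_le_one hs]; exact hs1
  have pt : ∀ x, (∑' n : ℕ, wfB N d μ (L / 2 ^ n) x ^ s) ^ q ≤
      (B x ^ (s * q)) ^ (1 - 1 / s) * (S x ^ (s * q)) ^ (1 / s) := by
    intro x
    have : ∑' n : ℕ, wfB N d μ (L / 2 ^ n) x ^ s ≤ B x ^ (s - 1) * S x := by
      rw [hS, ← ENNReal.tsum_mul_left]
      refine ENNReal.tsum_le_tsum fun n => ?_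
      have e : wfB N d μ (L / 2 ^ n) x ^ s = wfB N d μ (L / 2 ^ n) x ^ (s - 1) * wfB N d μ (L / 2 ^ n) x := by
        nth_rewrite 3 [← ENNReal.rpow_one (wfB N d μ (L / 2 ^ n) x)]
        rw [← ENNReal.rpow_add_of_nonneg _ _ (by linarith) (by norm_num)]
        congr 1; ring
      rw [e]
      gcongr
      exact le_iSup (fun n : ℕ => wfB N d μ (L / 2 ^ n) x) n
    refine (ENNReal.rpow_le_rpow this hq.le).trans (le_of_eq ?_)
    rw [ENNReal.mul_rpow_of_nonneg _ _ hq.le, ← ENNReal.rpow_mul, ← ENNReal.rpow_mul, ← ENNReal.rpow_mul]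
    congr 2 <;> field_simp
  refine (lintegral_mono pt).trans ?_
  refine (ENNReal.lintegral_mul_norm_pow_le (Bm.pow_const _).aemeasurable (Sm.pow_const _).aemeasurable
    (by linarith) (by positivity) (by ring)).trans ?_
  set Y := ∫⁻ x, B x ^ (s * q)
  calc _ ≤ Y ^ (1 - 1 / s) * ((C * ENNReal.ofReal (s * q)) ^ (s * q) * Y) ^ (1 / s) := by
        gcongr
    _ = (C * ENNReal.ofReal (s * q)) ^ q * (Y ^ (1 - 1 / s) * Y ^ (1 / s)) := by
        rw [ENNReal.mul_rpow_of_nonneg _ _ (by positivity : 0 ≤ 1 / s), ← ENNReal.rpow_mul,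
          show s * q * (1 / s) = q by field_simp]
        ring
    _ = (C * ENNReal.ofReal (s * q)) ^ q * Y := by
        rw [← ENNReal.rpow_add_of_nonneg _ _ (by linarith) (by positivity), sub_add_cancel, ENNReal.rpow_one]
    _ = _ := by
        rw [ENNReal.ofReal_mul hs.le, mul_assoc]

lemma wf_piece (N : ℕ) {d s : ℝ} (hd : 0 ≤ d) (hs : 0 < s) (μ : Measure (EuclideanSpace ℝ (Fin N)))
    (x : EuclideanSpace ℝ (Fin N)) {u v : ℝ} (hu : 0 < u) (huv : u ≤ v) :
    ∫⁻ t in Set.Ioc u v, (μ (Metric.ball x t) / ENNReal.ofReal (t ^ d)) ^ s * ENNReal.ofReal t⁻¹ ≤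
      ENNReal.ofReal ((v / u) ^ (d * s + 1)) * (μ (Metric.ball x v) / ENNReal.ofReal (v ^ d)) ^ s := by
  have hv : 0 < v := by linarith
  calc _ ≤ ∫⁻ t in Set.Ioc u v, (μ (Metric.ball x v) / ENNReal.ofReal (u ^ d)) ^ s * ENNReal.ofReal u⁻¹ := by
        refine setLIntegral_mono' measurableSet_Ioc fun t ht => ?_
        have := ht.1
        have := ht.2
        gcongr
    _ = (μ (Metric.ball x v) / ENNReal.ofReal (u ^ d)) ^ s * ENNReal.ofReal u⁻¹ * ENNReal.ofReal (v - u) := by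
        rw [setLIntegral_const, Real.volume_Ioc]
    _ ≤ (μ (Metric.ball x v) / ENNReal.ofReal (u ^ d)) ^ s * ENNReal.ofReal u⁻¹ * ENNReal.ofReal v := by
        gcongr; linarith
    _ = (μ (Metric.ball x v) / ENNReal.ofReal (u ^ d)) ^ s * ENNReal.ofReal (v / u) := by
        rw [mul_assoc, ← ENNReal.ofReal_mul (by positivity)]
        congr 2; field_simp
    _ = _ := by
        have e : μ (Metric.ball x v) / ENNReal.ofReal (u ^ d) =
            ENNReal.ofReal ((v / u) ^ d) * (μ (Metric.ball x v) / ENNReal.ofReal (v ^ d)) := by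
          simp only [ENNReal.div_eq_inv_mul]
          rw [← mul_assoc, ← ENNReal.ofReal_inv_of_pos (by positivity), ← ENNReal.ofReal_inv_of_pos (by positivity),
            ← ENNReal.ofReal_mul (by positivity)]
          congr 2
          rw [Real.div_rpow hv.le hu.le]
          have : v ^ d ≠ 0 := by positivity
          field_simp
        rw [e, ENNReal.mul_rpow_of_nonneg _ _ hs.le, ENNReal.ofReal_rpow_of_pos (by positivity),
          ← Real.rpow_mul (by positivity), Real.rpow_add (by positivity), Real.rpow_one,
          ENNReal.ofReal_mul (by positivity)]
        ring

lemma wf_small (N : ℕ) {d s : ℝ} (hd : 0 ≤ d) (hs : 0 < s) (μ : Measure (EuclideanSpace ℝ (Fin N)))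
    (x : EuclideanSpace ℝ (Fin N)) {L : ℝ} (hL : 0 < L) :
    ∫⁻ t in Set.Ioc 0 L, (μ (Metric.ball x t) / ENNReal.ofReal (t ^ d)) ^ s * ENNReal.ofReal t⁻¹ ≤
      ENNReal.ofReal (2 ^ (d * s + 1)) * ∑' n : ℕ, wfB N d μ (L / 2 ^ n) x ^ s := by
  have hsub : Set.Ioc 0 L ⊆ ⋃ n : ℕ, Set.Ioc (L / 2 ^ (n + 1)) (L / 2 ^ n) := by
    intro t ht
    obtain ⟨n, h1, h2⟩ := exists_nat_pow_near_of_lt_one (x := t / L) (y := (1 / 2 : ℝ))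
      (div_pos ht.1 hL) ((div_le_one hL).2 ht.2) (by norm_num) (by norm_num)
    rw [lt_div_iff₀ hL] at h1
    rw [div_le_iff₀ hL] at h2
    refine Set.mem_iUnion.2 ⟨n, ?_, ?_⟩
    · rw [one_div, inv_pow] at h1; rw [div_eq_inv_mul]; exact h1
    · rw [one_div, inv_pow] at h2; rw [div_eq_inv_mul]; exact h2
  refine (lintegral_mono_set hsub).trans ((lintegral_iUnion_le _ _).trans ?_)
  rw [← ENNReal.tsum_mul_left]
  refine ENNReal.tsum_le_tsum fun n => ?_
  have h0 : 0 < L / 2 ^ n := by positivity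
  refine (wf_piece N hd hs μ x (by positivity) (by gcongr <;> norm_num)).trans ?_
  have e : L / 2 ^ n / (L / 2 ^ (n + 1)) = 2 := by
    rw [pow_succ]; field_simp
  rw [e]
  gcongr
  rw [wfB]
  gcongr
  exact wf_ball_sub N h0 le_rfl x

lemma wf_B_le (N : ℕ) (hN : 0 < N) (α p : ℝ) (hd : 0 ≤ (N:ℝ) - α * p) (R : ℝ≥0∞)
    (μ : Measure (EuclideanSpace ℝ (Fin N))) (x : EuclideanSpace ℝ (Fin N)) {l : ℝ} (hl : 0 < l)
    (hR : ENNReal.ofReal (4 * N * l) ≤ R) :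
    wfB N ((N:ℝ) - α * p) μ l x ≤ ENNReal.ofReal ((4 * N) ^ ((N:ℝ) - α * p)) * fracMax N α p R μ x := by
  set d := (N:ℝ) - α * p with hd'
  have hN' : (0:ℝ) < N := by exact_mod_cast hN
  have h1 : μ (Metric.ball x (4 * N * l)) / ENNReal.ofReal ((4 * N * l) ^ d) ≤ fracMax N α p R μ x := by
    rw [fracMax]
    exact le_iSup₂_of_le (4 * N * l) ⟨by positivity, hR⟩ le_rfl
  calc wfB N d μ l x ≤ μ (Metric.ball x (4 * N * l)) / ENNReal.ofReal (l ^ d) := by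
        rw [wfB]; gcongr; exact wf_sub_ball N hN hl x
    _ = ENNReal.ofReal ((4 * N) ^ d) * (μ (Metric.ball x (4 * N * l)) / ENNReal.ofReal ((4 * N * l) ^ d)) := by
        simp only [ENNReal.div_eq_inv_mul]
        rw [← mul_assoc, ← ENNReal.ofReal_inv_of_pos (by positivity), ← ENNReal.ofReal_inv_of_pos (by positivity),
          ← ENNReal.ofReal_mul (by positivity)]
        congr 2
        rw [Real.mul_rpow (by positivity) hl.le]
        have : l ^ d ≠ 0 := by positivity
        have : (4 * (N:ℝ)) ^ d ≠ 0 := by positivity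
        field_simp
    _ ≤ _ := by gcongr

lemma wf_add_rpow (u v : ℝ≥0∞) {q : ℝ} (hq : 0 < q) : (u + v) ^ q ≤ (2 * u) ^ q + (2 * v) ^ q := by
  rcases le_total u v with h | h
  · refine le_trans (ENNReal.rpow_le_rpow ?_ hq.le) le_add_self
    rw [two_mul]; gcongr
  · refine le_trans (ENNReal.rpow_le_rpow ?_ hq.le) le_self_add
    rw [two_mul]; gcongr

lemma wf_core (N : ℕ) (α p : ℝ) (hα : 0 < α) (hp : 1 < p) (hαp : α * p < N) :
    ∃ D : ℝ≥0∞, D ≠ ∞ ∧ ∀ (R : ℝ≥0∞), 0 < R →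
      ∀ (μ : Measure (EuclideanSpace ℝ (Fin N))) (q : ℝ), p - 1 ≤ q →
        ∫⁻ x, (wolffE N α p R μ x) ^ q ≤ (D * ENNReal.ofReal q) ^ q *
          ∫⁻ x, (fracMax N α p R μ x) ^ (q / (p - 1)) := by
  have hap : 0 < α * p := by positivity
  have hN : 0 < N := by
    have : (0:ℝ) < N := by linarith
    exact_mod_cast this
  have hN' : (0:ℝ) < N := by exact_mod_cast hN
  have hp1 : 0 < p - 1 := by linarith
  set s : ℝ := 1 / (p - 1) with hs_def
  have hs : 0 < s := by positivity
  set d : ℝ := (N:ℝ) - α * p with hd_def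
  have hd : 0 ≤ d := by linarith
  obtain ⟨C, hC, hdisc⟩ := wf_disc N d (by linarith) hs
  set K2 : ℝ≥0∞ := ENNReal.ofReal (2 ^ (d * s + 1)) with hK2
  set K1 : ℝ≥0∞ := ENNReal.ofReal ((4 * N) ^ (d * s + 1)) with hK1
  set K3 : ℝ≥0∞ := ENNReal.ofReal ((4 * N) ^ d) with hK3
  have hK3s : K3 ^ s ≠ ∞ := ENNReal.rpow_ne_top_of_nonneg hs.le (by simp [hK3])
  set A : ℝ≥0∞ := 2 * (K2 * (C * K3 ^ s)) with hA
  have hAt : A ≠ ∞ := by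
    refine ENNReal.mul_ne_top (by simp) (ENNReal.mul_ne_top (by simp [hK2]) (ENNReal.mul_ne_top hC hK3s))
  set B : ℝ≥0∞ := 2 * K1 * ENNReal.ofReal s with hB
  have hBt : B ≠ ∞ := by
    refine ENNReal.mul_ne_top (ENNReal.mul_ne_top (by simp) (by simp [hK1])) (by simp)
  refine ⟨2 ^ s * (A + B), ENNReal.mul_ne_top (ENNReal.rpow_ne_top_of_nonneg hs.le (by simp))
    (ENNReal.add_ne_top.2 ⟨hAt, hBt⟩), ?_⟩
  intro R hR μ q hpq
  have hq : 0 < q := by linarith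
  have hsq : 1 ≤ s * q := by
    rw [hs_def, one_div_mul_eq_div, le_div_iff₀ hp1]; linarith
  rw [show q / (p - 1) = s * q by rw [hs_def, one_div_mul_eq_div]]
  set M := fracMax N α p R μ with hM
  set Y := ∫⁻ x, M x ^ (s * q) with hY
  set S : ℝ → EuclideanSpace ℝ (Fin N) → ℝ≥0∞ := fun L x => ∑' n : ℕ, wfB N d μ (L / 2 ^ n) x ^ s with hS
  have Sm : ∀ L, Measurable (S L) := fun L => Measurable.ennreal_tsum fun n => (wfB_meas _ _ _ _).pow_const s
  have hSb : ∀ L, 0 < L → ENNReal.ofReal (4 * N * L) ≤ R →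
      ∫⁻ x, (2 * (K2 * S L x)) ^ q ≤ (A * ENNReal.ofReal q) ^ q * Y := by
    intro L hL hLR
    have h1 := hdisc L hL μ q hq hsq
    have h2 : ∫⁻ x, (⨆ n : ℕ, wfB N d μ (L / 2 ^ n) x) ^ (s * q) ≤ (K3 ^ s) ^ q * Y := by
      rw [hY, ← lintegral_const_mul' _ _ (ENNReal.rpow_ne_top_of_nonneg hq.le hK3s)]
      refine lintegral_mono fun x => ?_
      rw [← ENNReal.rpow_mul, ← ENNReal.mul_rpow_of_nonneg _ _ (by positivity)]
      refine ENNReal.rpow_le_rpow (iSup_le fun n => ?_) (by positivity)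
      refine wf_B_le N hN α p hd R μ x (by positivity) (le_trans ?_ hLR)
      gcongr
      exact div_le_self hL.le (one_le_pow₀ (by norm_num))
    calc _ = (2 * K2) ^ q * ∫⁻ x, S L x ^ q := by
          rw [← lintegral_const_mul _ ((Sm L).pow_const q)]
          refine lintegral_congr fun x => ?_
          rw [← ENNReal.mul_rpow_of_nonneg _ _ hq.le, mul_assoc]
      _ ≤ (2 * K2) ^ q * ((C * ENNReal.ofReal q) ^ q * ((K3 ^ s) ^ q * Y)) := by
          gcongr
          exact h1.trans (by gcongr)
      _ = _ := by
          rw [← mul_assoc, ← mul_assoc, ← ENNReal.mul_rpow_of_nonneg _ _ hq.le, ← ENNReal.mul_rpow_of_nonneg _ _ hq.le]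
          congr 2
          rw [hA]; ring
  have hfin1 : (A * ENNReal.ofReal q) ^ q ≤ (2 ^ s * (A + B) * ENNReal.ofReal q) ^ q := by
    refine ENNReal.rpow_le_rpow ?_ hq.le
    gcongr
    calc A ≤ 1 * (A + B) := by rw [one_mul]; exact le_self_add
      _ ≤ _ := by
        gcongr
        exact ENNReal.one_le_rpow (by norm_num) hs
  by_cases hRt : R = ∞
  · have hset : {t : ℝ | 0 < t ∧ ENNReal.ofReal t < R} = ⋃ m : ℕ, Set.Ioc (0:ℝ) (2 ^ m) := by
      ext t
      simp only [hRt, Set.mem_setOf_eq, ENNReal.ofReal_lt_top, and_true, Set.mem_iUnion, Set.mem_Ioc]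
      constructor
      · intro ht
        obtain ⟨n, hn⟩ := pow_unbounded_of_one_lt t (by norm_num : (1:ℝ) < 2)
        exact ⟨n, ht, hn.le⟩
      · rintro ⟨n, hn⟩; exact hn.1
    have hW : ∀ x, wolffE N α p R μ x ≤ ⨆ m : ℕ, K2 * S (2 ^ m) x := by
      intro x
      rw [wolffE, hset, setLIntegral_iUnion_of_directed]
      · exact iSup_mono fun m => wf_small N hd hs μ x (by positivity)
      · refine directed_of_isDirected_le fun a b hab => ?_
        exact Set.Ioc_subset_Ioc le_rfl (pow_le_pow_right₀ (by norm_num) hab)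
    have hmono : ∀ x, Monotone fun m : ℕ => S (2 ^ m) x := by
      intro x
      refine monotone_nat_of_le_succ fun m => ?_
      simp only [hS]
      rw [tsum_eq_zero_add' (f := fun n : ℕ => wfB N d μ (2 ^ (m + 1) / 2 ^ n) x ^ s) ENNReal.summable]
      refine le_trans (le_of_eq ?_) le_add_self
      refine tsum_congr fun n => ?_
      congr 2
      rw [pow_succ, pow_succ]; field_simp
    calc _ ≤ ∫⁻ x, ⨆ m : ℕ, (2 * (K2 * S (2 ^ m) x)) ^ q := by
          refine lintegral_mono fun x => ?_
          rw [← wf_iSup_rpow _ hq]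
          refine ENNReal.rpow_le_rpow ((hW x).trans (iSup_mono fun m => ?_)) hq.le
          rw [two_mul]; exact le_self_add
      _ = ⨆ m : ℕ, ∫⁻ x, (2 * (K2 * S (2 ^ m) x)) ^ q := by
          refine lintegral_iSup (fun m => (((Sm _).const_mul _).const_mul _).pow_const q) ?_
          intro a b hab x
          refine ENNReal.rpow_le_rpow ?_ hq.le
          gcongr
          exact hmono x hab
      _ ≤ (A * ENNReal.ofReal q) ^ q * Y := iSup_le fun m => hSb _ (by positivity) (by rw [hRt]; exact le_top)
      _ ≤ _ := by gcongr
  · set r := R.toReal with hr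
    have hRr : R = ENNReal.ofReal r := (ENNReal.ofReal_toReal hRt).symm
    have hr0 : 0 < r := ENNReal.toReal_pos hR.ne' hRt
    set L := r / (4 * N) with hL
    have hL0 : 0 < L := by positivity
    have hLr : 4 * N * L = r := by rw [hL]; field_simp
    have hLle : L ≤ r := by
      have : (1:ℝ) ≤ N := by exact_mod_cast hN
      nlinarith
    have hW : ∀ x, wolffE N α p R μ x ≤ K2 * S L x + K1 * M x ^ s := by
      intro x
      have hsub : {t : ℝ | 0 < t ∧ ENNReal.ofReal t < R} ⊆ Set.Ioc 0 L ∪ Set.Ioc L r := by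
        rintro t ⟨h1, h2⟩
        rw [hRr, ENNReal.ofReal_lt_ofReal_iff hr0] at h2
        rw [Set.Ioc_union_Ioc_eq_Ioc hL0.le hLle]
        exact ⟨h1, h2.le⟩
      rw [wolffE]
      refine (lintegral_mono_set hsub).trans ((lintegral_union_le _ _ _).trans ?_)
      refine add_le_add (wf_small N hd hs μ x hL0) ?_
      refine (wf_piece N hd hs μ x hL0 hLle).trans ?_
      have e : r / L = 4 * N := by rw [hL]; field_simp
      rw [e]
      gcongr
      rw [hM, fracMax]
      exact le_iSup₂_of_le r ⟨hr0, hRr.ge⟩ le_rfl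
    have h2K1 : (2 * K1) ^ q ≠ ∞ := ENNReal.rpow_ne_top_of_nonneg hq.le (ENNReal.mul_ne_top (by simp) (by simp [hK1]))
    calc _ ≤ ∫⁻ x, ((2 * (K2 * S L x)) ^ q + (2 * K1) ^ q * M x ^ (s * q)) := by
          refine lintegral_mono fun x => ?_
          refine (ENNReal.rpow_le_rpow (hW x) hq.le).trans ((wf_add_rpow _ _ hq).trans (le_of_eq ?_))
          rw [← mul_assoc 2 K1, ENNReal.mul_rpow_of_nonneg (2 * K1) _ hq.le, ← ENNReal.rpow_mul]
      _ = (∫⁻ x, (2 * (K2 * S L x)) ^ q) + (2 * K1) ^ q * Y := by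
          rw [lintegral_add_left ((((Sm _).const_mul _).const_mul _).pow_const q), lintegral_const_mul' _ _ h2K1]
      _ ≤ (A * ENNReal.ofReal q) ^ q * Y + (B * ENNReal.ofReal q) ^ q * Y := by
          refine add_le_add (hSb L hL0 (by rw [hLr, hRr]))
            (mul_le_mul_left (ENNReal.rpow_le_rpow ?_ hq.le) _)
          · rw [hB, mul_assoc _ (ENNReal.ofReal s), ← ENNReal.ofReal_mul hs.le]
            calc 2 * K1 = 2 * K1 * 1 := by rw [mul_one]
              _ ≤ _ := by gcongr; exact ENNReal.one_le_ofReal.2 hsq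
      _ ≤ ((A + B) * ENNReal.ofReal q) ^ q * Y + ((A + B) * ENNReal.ofReal q) ^ q * Y := by
          gcongr
          · exact le_self_add
          · exact le_add_self
      _ = 2 * ((A + B) * ENNReal.ofReal q) ^ q * Y := by ring
      _ ≤ (2 ^ s) ^ q * ((A + B) * ENNReal.ofReal q) ^ q * Y := by
          gcongr
          rw [← ENNReal.rpow_mul]
          calc (2:ℝ≥0∞) = 2 ^ (1:ℝ) := by rw [ENNReal.rpow_one]
            _ ≤ _ := ENNReal.rpow_le_rpow_of_exponent_le (by norm_num) hsq
      _ = _ := by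
          rw [← ENNReal.mul_rpow_of_nonneg _ _ hq.le, mul_assoc (2 ^ s)]

theorem fracMax_Lq_lower_bound_wolff (N : ℕ) (α p : ℝ)
    (hα : 0 < α) (hp : 1 < p) (hαp : α * p < N) :
    ∃ c : ℝ, 0 < c ∧ ∀ (R : ℝ≥0∞), 0 < R →
      ∀ (μ : Measure (EuclideanSpace ℝ (Fin N))) (q : ℝ), p - 1 ≤ q →
        ENNReal.ofReal ((c * q) ^ (-q)) * ∫⁻ x, (wolffE N α p R μ x) ^ q ≤
          ∫⁻ x, (fracMax N α p R μ x) ^ (q / (p - 1)) := by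
  obtain ⟨D, hD, h⟩ := wf_core N α p hα hp hαp
  refine ⟨D.toReal + 1, by positivity, ?_⟩
  intro R hR μ q hpq
  have hq : 0 < q := by linarith
  have hcq : 0 < (D.toReal + 1) * q := by positivity
  have hle : (D * ENNReal.ofReal q) ^ q ≤ ENNReal.ofReal (((D.toReal + 1) * q) ^ q) := by
    rw [← ENNReal.ofReal_rpow_of_pos hcq]
    refine ENNReal.rpow_le_rpow ?_ hq.le
    rw [ENNReal.ofReal_mul (by positivity)]
    gcongr
    calc D = ENNReal.ofReal D.toReal := (ENNReal.ofReal_toReal hD).symm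
      _ ≤ _ := ENNReal.ofReal_le_ofReal (by linarith)
  calc _ ≤ ENNReal.ofReal (((D.toReal + 1) * q) ^ (-q)) *
        (ENNReal.ofReal (((D.toReal + 1) * q) ^ q) *
          ∫⁻ x, (fracMax N α p R μ x) ^ (q / (p - 1))) := by
        gcongr
        exact (h R hR μ q hpq).trans (by gcongr)
    _ = _ := by
        rw [← mul_assoc, ← ENNReal.ofReal_mul (by positivity), ← Real.rpow_add hcq]
        simp
end
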